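/- Let S be a caterpillar with k ≥ 10 vertices that is not a path, has at least four internal vertices, and has a vertex v_S that is the root of a fork of order 1 and is adjacent to a leaf. If T is a tree with radius at least 4k, then d(S,T) ≤ 1 - 10^{-3}. -/

import Mathlib

open SimpleGraph Filter

/-- The degree of a vertex, as the cardinality of its neighbour set. -/
noncomputable def ndeg {V : Type*} (G : SimpleGraph V) (v : V) : ℕ :=
  (G.neighborSet v).ncard

/-- `Z_k(G)`: the number of `k`-vertex subtrees (connected subgraphs) of `G`. -/
noncomputable def subtreeCount {V : Type*} [Fintype V] (G : SimpleGraph V) (k : ℕ) : ℕ :=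
  {s : Finset V | s.card = k ∧ (G.induce (s : Set V)).Connected}.ncard

/-- The number of embeddings (subtrees isomorphic to `S`) of a tree `S` in `G`,
counted among `k`-vertex subtrees. -/
noncomputable def embCount {V W : Type*} [Fintype V] (G : SimpleGraph V)
    (S : SimpleGraph W) (k : ℕ) : ℕ :=
  {s : Finset V | s.card = k ∧ Nonempty ((G.induce (s : Set V)) ≃g S)}.ncard

/-- The density `d(S,T)`: the number of embeddings of the `|S|`-vertex tree `S` in `T`
divided by the number of `|S|`-vertex subtrees of `T` (`0` if `T` has fewer vertices). -/
noncomputable def density {V W : Type*} [Fintype V] [Fintype W]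
    (S : SimpleGraph W) (T : SimpleGraph V) : ℝ :=
  (embCount T S (Fintype.card W) : ℝ) / (subtreeCount T (Fintype.card W) : ℝ)

/-- `max { d(S,T) : T an n-vertex tree }`. -/
noncomputable def maxDensity {W : Type*} [Fintype W] (S : SimpleGraph W) (n : ℕ) : ℝ :=
  sSup {x : ℝ | ∃ T : SimpleGraph (Fin n), T.IsTree ∧ x = density S T}

/-- The inducibility of `S`: `limsup_{n → ∞} max { d(S,T) : T an n-vertex tree }`. -/
noncomputable def inducibility {W : Type*} [Fintype W] (S : SimpleGraph W) : ℝ :=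
  Filter.limsup (maxDensity S) Filter.atTop

/-- A graph is starlike if it has at most one non-leaf vertex. -/
def IsStarlike {V : Type*} (G : SimpleGraph V) : Prop :=
  {v | ndeg G v ≠ 1}.Subsingleton

/-- A graph is pathlike if its maximum degree is at most 2. -/
def IsPathlike {V : Type*} (G : SimpleGraph V) : Prop :=
  ∀ v, ndeg G v ≤ 2

/-- The vertex set of the component of `u` in `G - v`; together with the edge `uv`, this is
the branch of `G` rooted at `v` through its neighbour `u`. -/
def branchSet {V : Type*} (G : SimpleGraph V) (v u : V) : Set V :=
  {w | ∃ p : G.Walk u w, v ∉ p.support}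

/-- The branch of `G` rooted at `v` through `u` is non-trivial if it is not a single edge. -/
def NontrivialBranch {V : Type*} (G : SimpleGraph V) (v u : V) : Prop :=
  G.Adj v u ∧ branchSet G v u ≠ {u}

/-- The branch rooted at `v` through `u` is a fork: non-trivial and isomorphic to a star in
which `v` is a leaf (all vertices of the branch other than `u` and `v` are leaves of `G`). -/
def IsFork {V : Type*} (G : SimpleGraph V) (v u : V) : Prop :=
  NontrivialBranch G v u ∧ ∀ w ∈ branchSet G v u, w ≠ u → ndeg G w = 1

/-- The order of a fork: its number of leaves other than the root. -/
noncomputable def forkOrder {V : Type*} (G : SimpleGraph V) (v u : V) : ℕ :=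
  (branchSet G v u).ncard - 1

/-- A branch is major if it is non-trivial and not a fork. -/
def IsMajor {V : Type*} (G : SimpleGraph V) (v u : V) : Prop :=
  NontrivialBranch G v u ∧ ¬ IsFork G v u

/-- A caterpillar is a tree in which every vertex is the root of at most two
non-trivial branches. -/
def IsCaterpillar {V : Type*} (G : SimpleGraph V) : Prop :=
  G.IsTree ∧ ∀ v, {u | NontrivialBranch G v u}.ncard ≤ 2

/-- A center of `G`: each branch rooted at `v` has at most `|G|/2` edges (the branch through
a neighbour `u` has `(branchSet G v u).ncard` edges). -/
def IsCenter {V : Type*} [Fintype V] (G : SimpleGraph V) (v : V) : Prop :=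
  ∀ u, G.Adj v u → 2 * (branchSet G v u).ncard ≤ Fintype.card V

/-- `v` is the root of at least three non-trivial branches. -/
def RootsThreeNontrivial {V : Type*} (G : SimpleGraph V) (v : V) : Prop :=
  3 ≤ {u | NontrivialBranch G v u}.ncard

/-- A hub of `G`: a vertex `v` that is the only vertex on the path from `v` to the nearest
center of `G` that is the root of at least three non-trivial branches.  (A vertex `w` lies on
the path from `v` to `c` iff `dist v w + dist w c = dist v c`.) -/
def IsHub {V : Type*} [Fintype V] (G : SimpleGraph V) (v : V) : Prop :=
  RootsThreeNontrivial G v ∧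
  ∃ c, IsCenter G c ∧ (∀ c', IsCenter G c' → G.dist v c ≤ G.dist v c') ∧
    ∀ w, G.dist v w + G.dist w c = G.dist v c → w ≠ v → ¬ RootsThreeNontrivial G w

section TreeDist
variable {V : Type*} {T : SimpleGraph V}

lemma exists_adj_dist_lt (hT : T.Connected) {v a : V} (h : a ≠ v) :
    ∃ b, T.Adj a b ∧ T.dist v a = T.dist v b + 1 := by
  obtain ⟨p, hp⟩ := hT.exists_walk_length_eq_dist a v
  cases p with
  | nil => exact absurd rfl h
  | cons hab q =>
    rename_i b
    refine ⟨b, hab, ?_⟩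
    have h1 := dist_le q
    have h2 := hT.dist_triangle (u := v) (v := b) (w := a)
    have h3 : T.dist b a = 1 := dist_eq_one_iff_adj.2 hab.symm
    rw [Walk.length_cons] at hp
    rw [dist_comm (u := a) (v := v)] at hp
    rw [dist_comm (u := b) (v := v)] at h1
    omega

lemma eq_of_adj_of_dist_lt (hT : T.IsTree) {v a b c : V} (hab : T.Adj a b) (hac : T.Adj a c)
    (hb : T.dist v b < T.dist v a) (hc : T.dist v c < T.dist v a) : b = c := by
  have key : ∀ d, T.Adj a d → T.dist v d < T.dist v a → ∃ p : T.Walk v a, p.IsPath ∧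
      p.penultimate = d := by
    intro d had hd
    obtain ⟨p, hp⟩ := hT.connected.exists_walk_length_eq_dist v d
    refine ⟨p.concat had.symm, ?_, by simp⟩
    apply Walk.isPath_of_length_eq_dist
    have := hT.dist_eq_dist_add_one_of_adj v had
    rw [Walk.length_concat]
    omega
  obtain ⟨p, hp, rfl⟩ := key b hab hb
  obtain ⟨q, hq, rfl⟩ := key c hac hc
  rw [(hT.existsUnique_path v a).unique hp hq]

/-- Adjacent vertices of a tree on different sides of the edge `vw` are `v` and `w`. -/
lemma eq_of_adj_of_sides (hT : T.IsTree) {v w a b : V} (hvw : T.Adj v w) (hab : T.Adj a b)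
    (ha : T.dist w a < T.dist v a) (hb : ¬ T.dist w b < T.dist v b) : a = w ∧ b = v := by
  have hc := hT.connected
  have e1 := hT.dist_eq_dist_add_one_of_adj a hvw
  have e2 := hT.dist_eq_dist_add_one_of_adj b hvw
  have e3 := hT.dist_eq_dist_add_one_of_adj v hab
  have e4 := hT.dist_eq_dist_add_one_of_adj w hab
  rw [dist_comm (u := a) (v := v), dist_comm (u := a) (v := w)] at e1
  rw [dist_comm (u := b) (v := v), dist_comm (u := b) (v := w)] at e2
  by_cases haw : a = w
  · subst haw
    have h0 : T.dist a a = 0 := dist_self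
    have : T.dist v b = 0 := by omega
    exact ⟨rfl, ((hc.dist_eq_zero_iff).1 this).symm⟩
  · obtain ⟨a', haa', hd⟩ := exists_adj_dist_lt hc haw
    have e5 := hc.dist_triangle (u := v) (v := w) (w := a')
    have e6 : T.dist v w = 1 := dist_eq_one_iff_adj.2 hvw
    have : b = a' := eq_of_adj_of_dist_lt hT (v := v) hab haa' (by omega) (by omega)
    subst this
    omega

end TreeDist

section DegIn
open scoped Classical
variable {V : Type*} (T : SimpleGraph V)

/-- The degree of `a` in the subgraph induced by `s`. -/
noncomputable def degIn (s : Finset V) (a : V) : ℕ := (s.filter (T.Adj a)).card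

/-- The leaves of the subgraph induced by `s`. -/
noncomputable def leavesIn (s : Finset V) : Finset V := s.filter (fun a => degIn T s a = 1)

/-- The leaves of the subgraph induced by `s` that have a neighbour of degree two. -/
noncomputable def deepLeavesIn (s : Finset V) : Finset V :=
  s.filter (fun a => degIn T s a = 1 ∧ ∃ b ∈ s, T.Adj a b ∧ degIn T s b = 2)

/-- `s` contains `v`, and every other element of `s` has a neighbour in `s` nearer to `v`. -/
def RootedAt (v : V) (s : Finset V) : Prop :=
  v ∈ s ∧ ∀ a ∈ s, a ≠ v → ∃ b ∈ s, T.Adj a b ∧ T.dist v b < T.dist v a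

variable {T}

lemma RootedAt.connected {v : V} {s : Finset V} (h : RootedAt T v s) :
    (T.induce (s : Set V)).Connected := by
  have key : ∀ n, ∀ a, ∀ ha : a ∈ s, T.dist v a = n →
      (T.induce (s : Set V)).Reachable ⟨v, h.1⟩ ⟨a, ha⟩ := by
    intro n
    induction n using Nat.strong_induction_on with
    | _ n ih =>
      intro a ha hn
      by_cases hav : a = v
      · subst hav; exact Reachable.refl _
      · obtain ⟨b, hb, hab, hlt⟩ := h.2 a ha hav
        refine (ih _ (hn ▸ hlt) b hb rfl).trans (Adj.reachable ?_)
        simpa using hab.symm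
  rw [connected_iff_exists_forall_reachable]
  exact ⟨⟨v, h.1⟩, fun ⟨a, ha⟩ => key _ a ha rfl⟩

lemma rootedAt_of_connected (hT : T.IsTree) {v : V} {s : Finset V} (hv : v ∈ s)
    (h : (T.induce (s : Set V)).Connected) : RootedAt T v s := by
  have hc := hT.connected
  have key : ∀ a : (s : Set V), ∀ c, T.dist v c + T.dist c a = T.dist v a → c ∈ s := by
    intro a
    obtain ⟨p⟩ := h.preconnected a ⟨v, hv⟩
    generalize hv' : (⟨v, hv⟩ : (s : Set V)) = v' at p
    induction p with
    | nil =>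
      subst hv'
      intro c hcc
      change T.dist v c + T.dist c v = T.dist v v at hcc
      rw [dist_self] at hcc
      have : T.dist v c = 0 := by omega
      rw [hc.dist_eq_zero_iff] at this
      subst this; exact hv
    | cons hab q ih =>
      rename_i a b u
      intro c hcc
      have hab : T.Adj a b := by simpa using hab
      have ih := ih hv'
      have e3 := hT.dist_eq_dist_add_one_of_adj v hab
      have e4 := hT.dist_eq_dist_add_one_of_adj c hab
      have tri := hc.dist_triangle (u := v) (v := c) (w := b)
      by_cases hca : (a : V) = c
      · rw [← hca]; exact a.2
      rcases e3 with e3 | e3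
      · obtain ⟨a', haa', hd⟩ := exists_adj_dist_lt hc hca
        have tri' := hc.dist_triangle (u := v) (v := c) (w := a')
        have : (b : V) = a' := eq_of_adj_of_dist_lt hT (v := v) hab haa' (by omega) (by omega)
        subst this
        apply ih; omega
      · apply ih; omega
  refine ⟨hv, fun a ha hav => ?_⟩
  obtain ⟨b, hab, hd⟩ := exists_adj_dist_lt hc hav
  refine ⟨b, key ⟨a, ha⟩ b ?_, hab, by omega⟩
  have : T.dist b a = 1 := dist_eq_one_iff_adj.2 hab.symm
  simp only; omega

lemma RootedAt.dist_lt_card {v a : V} {s : Finset V} (hT : T.IsTree) (h : RootedAt T v s)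
    (ha : a ∈ s) : T.dist v a < s.card := by
  have key : ∀ n, ∀ a ∈ s, T.dist v a = n → Finset.range (n + 1) ⊆ s.image (T.dist v) := by
    intro n
    induction n with
    | zero =>
      intro a ha hn
      rw [zero_add, Finset.range_one, Finset.singleton_subset_iff]
      exact Finset.mem_image.2 ⟨a, ha, hn⟩
    | succ n ih =>
      intro a ha hn
      have hav : a ≠ v := by rintro rfl; simp at hn
      obtain ⟨b, hb, hab, hlt⟩ := h.2 a ha hav
      have := hT.dist_eq_dist_add_one_of_adj v hab
      rw [Finset.range_add_one, Finset.insert_subset_iff]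
      exact ⟨Finset.mem_image.2 ⟨a, ha, hn⟩, ih b hb (by omega)⟩
  have := (Finset.card_le_card (key _ a ha rfl)).trans Finset.card_image_le
  simpa using this

lemma degIn_mono {s t : Finset V} (h : s ⊆ t) (a : V) : degIn T s a ≤ degIn T t a :=
  Finset.card_le_card (Finset.filter_subset_filter _ h)

lemma degIn_congr {s t : Finset V} {a : V} (h : ∀ b, T.Adj a b → (b ∈ s ↔ b ∈ t)) :
    degIn T s a = degIn T t a := by
  unfold degIn
  congr 1
  ext b
  simp only [Finset.mem_filter]
  exact ⟨fun ⟨h1, h2⟩ => ⟨(h b h2).1 h1, h2⟩, fun ⟨h1, h2⟩ => ⟨(h b h2).2 h1, h2⟩⟩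

lemma two_le_degIn {s : Finset V} {a b c : V} (hb : b ∈ s) (hc : c ∈ s) (hab : T.Adj a b)
    (hac : T.Adj a c) (hbc : b ≠ c) : 2 ≤ degIn T s a := by
  have := Finset.one_lt_card.2 ⟨b, Finset.mem_filter.2 ⟨hb, hab⟩, c, Finset.mem_filter.2 ⟨hc, hac⟩,
    hbc⟩
  exact this

lemma eq_of_degIn_eq_one {s : Finset V} {a b c : V} (h : degIn T s a = 1) (hb : b ∈ s) (hc : c ∈ s)
    (hab : T.Adj a b) (hac : T.Adj a c) : b = c := by
  by_contra hbc
  have := two_le_degIn hb hc hab hac hbc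
  omega

lemma exists_adj_of_two_le_degIn {s : Finset V} {a : V} (h : 2 ≤ degIn T s a) (c : V) :
    ∃ b ∈ s, T.Adj a b ∧ b ≠ c := by
  obtain ⟨x, hx, y, hy, hxy⟩ := Finset.one_lt_card.1 (show 1 < (s.filter (T.Adj a)).card from h)
  rw [Finset.mem_filter] at hx hy
  by_cases hxc : x = c
  · exact ⟨y, hy.1, hy.2, fun h => hxy (hxc.trans h.symm)⟩
  · exact ⟨x, hx.1, hx.2, hxc⟩

/-- In a rooted set, a vertex outside has at most one neighbour inside. -/
lemma RootedAt.eq_of_adj_of_notMem (hT : T.IsTree) {v y q z : V} {s : Finset V}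
    (h : RootedAt T v s) (hy : y ∉ s) (hq : q ∈ s) (hz : z ∈ s) (hyq : T.Adj y q)
    (hyz : T.Adj y z) : z = q := by
  have key : ∀ q ∈ s, T.Adj y q → T.dist v q < T.dist v y := by
    intro q hq hyq
    by_contra hlt
    have e := hT.dist_eq_dist_add_one_of_adj v hyq
    have hqv : q ≠ v := by rintro rfl; simp only [dist_self] at e hlt; omega
    obtain ⟨b, hb, hqb, hd⟩ := h.2 q hq hqv
    exact hy (eq_of_adj_of_dist_lt hT (v := v) hqb hyq.symm hd (by omega) ▸ hb)
  exact eq_of_adj_of_dist_lt hT hyz hyq (key z hz hyz) (key q hq hyq)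

lemma RootedAt.insert_adj {v y q : V} {s : Finset V} (hT : T.IsTree)
    (h : RootedAt T v s) (hy : y ∉ s) (hq : q ∈ s) (hyq : T.Adj y q) :
    RootedAt T v (insert y s) := by
  refine ⟨Finset.mem_insert_of_mem h.1, fun a ha hav => ?_⟩
  rcases Finset.mem_insert.1 ha with rfl | ha
  · obtain ⟨b, hab, hd⟩ := exists_adj_dist_lt hT.connected hav
    refine ⟨q, Finset.mem_insert_of_mem hq, hyq, ?_⟩
    by_contra hlt
    have e := hT.dist_eq_dist_add_one_of_adj v hyq
    have hqv : q ≠ v := by rintro rfl; simp only [dist_self] at e hlt; omega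
    obtain ⟨c, hc, hqc, hd'⟩ := h.2 q hq hqv
    exact hy (eq_of_adj_of_dist_lt hT (v := v) hqc hyq.symm hd' (by omega) ▸ hc)
  · obtain ⟨b, hb, h'⟩ := h.2 a ha hav
    exact ⟨b, Finset.mem_insert_of_mem hb, h'⟩

section Insert
variable {v y q : V} {s : Finset V}

lemma RootedAt.degIn_insert_self (hT : T.IsTree) (h : RootedAt T v s) (hy : y ∉ s) (hq : q ∈ s)
    (hyq : T.Adj y q) : degIn T (insert y s) y = 1 := by
  unfold degIn
  rw [Finset.card_eq_one]
  refine ⟨q, ?_⟩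
  ext z
  simp only [Finset.mem_filter, Finset.mem_insert, Finset.mem_singleton]
  constructor
  · rintro ⟨rfl | hz, hyz⟩
    · exact absurd hyz (T.loopless.irrefl _)
    · exact h.eq_of_adj_of_notMem hT hy hq hz hyq hyz
  · rintro rfl; exact ⟨Or.inr hq, hyq⟩

lemma RootedAt.degIn_insert_of_ne (hT : T.IsTree) (h : RootedAt T v s) (hy : y ∉ s) (hq : q ∈ s)
    (hyq : T.Adj y q) {a : V} (ha : a ∈ s) (haq : a ≠ q) :
    degIn T (insert y s) a = degIn T s a := by
  apply degIn_congr
  intro b hab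
  rw [Finset.mem_insert]
  refine ⟨fun hb => hb.resolve_left ?_, Or.inr⟩
  rintro rfl
  exact haq (h.eq_of_adj_of_notMem hT hy hq ha hyq hab.symm)

lemma degIn_insert_adj (hy : y ∉ s) (hyq : T.Adj y q) :
    degIn T (insert y s) q = degIn T s q + 1 := by
  unfold degIn
  rw [Finset.filter_insert, if_pos hyq.symm, Finset.card_insert_of_notMem]
  simp [hy]

lemma RootedAt.card_leavesIn_insert_of_leaf (hT : T.IsTree) (h : RootedAt T v s) (hy : y ∉ s)
    (hq : q ∈ s) (hyq : T.Adj y q) (hd : degIn T s q = 1) :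
    (leavesIn T (insert y s)).card = (leavesIn T s).card := by
  have hqL : q ∈ leavesIn T s := Finset.mem_filter.2 ⟨hq, hd⟩
  have : leavesIn T (insert y s) = insert y ((leavesIn T s).erase q) := by
    ext a
    simp only [leavesIn, Finset.mem_filter, Finset.mem_insert, Finset.mem_erase]
    by_cases hay : a = y
    · subst hay; simp [h.degIn_insert_self hT hy hq hyq]
    by_cases haq : a = q
    · subst haq; simp [degIn_insert_adj hy hyq, hd, hay]
    by_cases has : a ∈ s
    · simp [h.degIn_insert_of_ne hT hy hq hyq has haq, hay, haq, has]
    · simp [hay, has]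
  rw [this, Finset.card_insert_of_notMem, Finset.card_erase_add_one hqL]
  simp [leavesIn, hy]

lemma RootedAt.card_leavesIn_insert_of_inner (hT : T.IsTree) (h : RootedAt T v s) (hy : y ∉ s)
    (hq : q ∈ s) (hyq : T.Adj y q) (hd : 2 ≤ degIn T s q) :
    (leavesIn T (insert y s)).card = (leavesIn T s).card + 1 := by
  have : leavesIn T (insert y s) = insert y (leavesIn T s) := by
    ext a
    simp only [leavesIn, Finset.mem_filter, Finset.mem_insert]
    by_cases hay : a = y
    · subst hay; simp [h.degIn_insert_self hT hy hq hyq]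
    by_cases haq : a = q
    · subst haq; simp [degIn_insert_adj hy hyq, hay]; omega
    by_cases has : a ∈ s
    · simp [h.degIn_insert_of_ne hT hy hq hyq has haq, hay, has]
    · simp [hay, has]
  rw [this, Finset.card_insert_of_notMem]
  simp [leavesIn, hy]

end Insert
end DegIn

section Stem
open scoped Classical
variable {V : Type*} [Fintype V] (T : SimpleGraph V)

/-- The neighbours of `v` other than `w`. -/
noncomputable def sideNbrs (v w : V) : Finset V := Finset.univ.filter fun a => T.Adj v a ∧ a ≠ w

/-- The vertices other than `v` that are adjacent to an element of `P`. -/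
noncomputable def childrenOf (v : V) (P : Finset V) : Finset V :=
  P.biUnion fun a => sideNbrs T a v

/-- A connected vertex set in which `v` is a leaf with neighbour `w`. -/
structure IsStem (v w : V) (R : Finset V) : Prop where
  adj : T.Adj v w
  root : RootedAt T v R
  mem : w ∈ R
  side : ∀ z ∈ R, z ≠ v → T.dist w z < T.dist v z

variable {T} {v w : V} {R P Q : Finset V}

lemma mem_sideNbrs {a : V} : a ∈ sideNbrs T v w ↔ T.Adj v a ∧ a ≠ w := by simp [sideNbrs]

lemma mem_childrenOf {q : V} : q ∈ childrenOf T v P ↔ ∃ p ∈ P, T.Adj p q ∧ q ≠ v := by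
  simp [childrenOf, mem_sideNbrs]

lemma dist_sideNbrs {p : V} (hp : p ∈ sideNbrs T v w) : T.dist v p = 1 :=
  dist_eq_one_iff_adj.2 (mem_sideNbrs.1 hp).1

lemma not_side_of_mem_sideNbrs (hT : T.IsTree) {p : V} (hp : p ∈ sideNbrs T v w) :
    ¬ T.dist w p < T.dist v p := by
  rw [dist_sideNbrs hp, Nat.lt_one_iff, hT.connected.dist_eq_zero_iff]
  exact fun h => (mem_sideNbrs.1 hp).2 h.symm

lemma dist_childrenOf (hT : T.IsTree) {q : V} (hP : P ⊆ sideNbrs T v w)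
    (hq : q ∈ childrenOf T v P) : T.dist v q = 2 := by
  obtain ⟨p, hp, hpq, hqv⟩ := mem_childrenOf.1 hq
  have h1 := dist_sideNbrs (hP hp)
  have h2 := hT.dist_eq_dist_add_one_of_adj v hpq
  have h3 : T.dist v q ≠ 0 := by
    rw [Ne, hT.connected.dist_eq_zero_iff]; exact fun h => hqv h.symm
  omega

lemma not_side_of_mem_childrenOf (hT : T.IsTree) {q : V} (hvw : T.Adj v w)
    (hP : P ⊆ sideNbrs T v w) (hq : q ∈ childrenOf T v P) : ¬ T.dist w q < T.dist v q := by
  obtain ⟨p, hp, hpq, hqv⟩ := mem_childrenOf.1 hq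
  intro hlt
  have := (eq_of_adj_of_sides hT hvw hpq.symm hlt (not_side_of_mem_sideNbrs hT (hP hp))).2
  have h1 := (mem_sideNbrs.1 (hP hp)).1
  rw [this] at h1
  exact T.loopless.irrefl _ h1

/-- The elements of `P ∪ Q` lie on the side of `v`, and differ from `v`. -/
lemma not_side_of_mem (hT : T.IsTree) (hvw : T.Adj v w) (hP : P ⊆ sideNbrs T v w)
    (hQ : Q ⊆ childrenOf T v P) {a : V} (ha : a ∈ P ∨ a ∈ Q) :
    a ≠ v ∧ ¬ T.dist w a < T.dist v a := by
  rcases ha with ha | ha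
  · exact ⟨((mem_sideNbrs.1 (hP ha)).1).ne', not_side_of_mem_sideNbrs hT (hP ha)⟩
  · obtain ⟨p, hp, hpq, hqv⟩ := mem_childrenOf.1 (hQ ha)
    exact ⟨hqv, not_side_of_mem_childrenOf hT hvw hP (hQ ha)⟩

namespace IsStem

lemma disjoint (hT : T.IsTree) (h : IsStem T v w R) (hP : P ⊆ sideNbrs T v w)
    (hQ : Q ⊆ childrenOf T v P) : Disjoint R (P ∪ Q) := by
  rw [Finset.disjoint_left]
  intro a haR ha
  have := not_side_of_mem hT h.adj hP hQ (Finset.mem_union.1 ha)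
  exact this.2 (h.side a haR this.1)

lemma disjoint' (hT : T.IsTree) (hP : P ⊆ sideNbrs T v w)
    (hQ : Q ⊆ childrenOf T v P) : Disjoint P Q := by
  rw [Finset.disjoint_left]
  intro a haP ha
  have h1 := dist_sideNbrs (hP haP)
  have h2 := dist_childrenOf hT hP (hQ ha)
  omega

lemma card_config (hT : T.IsTree) (h : IsStem T v w R) (hP : P ⊆ sideNbrs T v w)
    (hQ : Q ⊆ childrenOf T v P) : (R ∪ P ∪ Q).card = R.card + P.card + Q.card := by
  rw [Finset.union_assoc, Finset.card_union_of_disjoint (h.disjoint hT hP hQ),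
    Finset.card_union_of_disjoint (disjoint' hT hP hQ), add_assoc]

lemma rootedAt_config (hT : T.IsTree) (h : IsStem T v w R) (hP : P ⊆ sideNbrs T v w)
    (hQ : Q ⊆ childrenOf T v P) : RootedAt T v (R ∪ P ∪ Q) := by
  refine ⟨by simp [h.root.1], fun a ha hav => ?_⟩
  rw [Finset.mem_union, Finset.mem_union] at ha
  rcases ha with (ha | ha) | ha
  · obtain ⟨b, hb, h'⟩ := h.root.2 a ha hav
    exact ⟨b, by simp [hb], h'⟩
  · refine ⟨v, by simp [h.root.1], (mem_sideNbrs.1 (hP ha)).1.symm, ?_⟩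
    rw [dist_sideNbrs (hP ha), dist_self]; exact one_pos
  · obtain ⟨p, hp, hpq, -⟩ := mem_childrenOf.1 (hQ ha)
    refine ⟨p, by simp [hp], hpq.symm, ?_⟩
    rw [dist_sideNbrs (hP hp), dist_childrenOf hT hP (hQ ha)]; exact one_lt_two

lemma mem_of_adj (hT : T.IsTree) (h : IsStem T v w R) (hP : P ⊆ sideNbrs T v w)
    (hQ : Q ⊆ childrenOf T v P) {a b : V} (ha : a ∈ R) (hav : a ≠ v) (hb : b ∈ R ∪ P ∪ Q)
    (hab : T.Adj a b) : b ∈ R := by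
  rw [Finset.mem_union, Finset.mem_union, or_assoc] at hb
  rcases hb with hb | hb
  · exact hb
  · have h1 := not_side_of_mem hT h.adj hP hQ hb
    exact absurd (eq_of_adj_of_sides hT h.adj hab (h.side a ha hav) h1.2).2 h1.1

lemma degIn_core (hT : T.IsTree) (h : IsStem T v w R) (hP : P ⊆ sideNbrs T v w)
    (hQ : Q ⊆ childrenOf T v P) {a : V} (ha : a ∈ R) (hav : a ≠ v) :
    degIn T (R ∪ P ∪ Q) a = degIn T R a :=
  degIn_congr fun b hab => ⟨fun hb => h.mem_of_adj hT hP hQ ha hav hb hab, fun hb => by simp [hb]⟩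

lemma degIn_root (hT : T.IsTree) (h : IsStem T v w R) (hP : P ⊆ sideNbrs T v w)
    (hQ : Q ⊆ childrenOf T v P) : degIn T (R ∪ P ∪ Q) v = P.card + 1 := by
  unfold degIn
  have : (R ∪ P ∪ Q).filter (T.Adj v) = insert w P := by
    ext a
    simp only [Finset.mem_filter, Finset.mem_union, Finset.mem_insert]
    constructor
    · rintro ⟨(ha | ha) | ha, hva⟩
      · left
        exact (eq_of_adj_of_sides hT h.adj hva.symm (h.side a ha hva.ne') (by simp)).1
      · exact Or.inr ha
      · have := dist_childrenOf hT hP (hQ ha)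
        rw [dist_eq_one_iff_adj.2 hva] at this
        omega
    · rintro (rfl | ha)
      · exact ⟨Or.inl (Or.inl h.mem), h.adj⟩
      · exact ⟨Or.inl (Or.inr ha), (mem_sideNbrs.1 (hP ha)).1⟩
  rw [this, Finset.card_insert_of_notMem]
  exact fun hw => (mem_sideNbrs.1 (hP hw)).2 rfl

lemma adj_of_mem_left (hT : T.IsTree) (h : IsStem T v w R) (hP : P ⊆ sideNbrs T v w)
    (hQ : Q ⊆ childrenOf T v P) {p b : V} (hp : p ∈ P) (hb : b ∈ R ∪ P ∪ Q) (hpb : T.Adj p b) :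
    b = v ∨ b ∈ Q := by
  by_contra! hcon
  rw [Finset.mem_union, Finset.mem_union] at hb
  rcases hb with (hb | hb) | hb
  · have := h.mem_of_adj hT hP hQ hb hcon.1 (by simp [hp]) hpb.symm
    exact Finset.disjoint_left.1 (h.disjoint hT hP hQ) this (by simp [hp])
  · apply hT.dist_ne_of_adj v hpb
    rw [dist_sideNbrs (hP hb), dist_sideNbrs (hP hp)]
  · exact hcon.2 hb

lemma degIn_left (hT : T.IsTree) (h : IsStem T v w R) (hP : P ⊆ sideNbrs T v w)
    (hQ : Q ⊆ childrenOf T v P) {p : V} (hp : p ∈ P) :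
    degIn T (R ∪ P ∪ Q) p = (Q.filter (T.Adj p)).card + 1 := by
  unfold degIn
  have : (R ∪ P ∪ Q).filter (T.Adj p) = insert v (Q.filter (T.Adj p)) := by
    ext a
    simp only [Finset.mem_filter, Finset.mem_insert]
    constructor
    · rintro ⟨ha, hpa⟩
      exact (h.adj_of_mem_left hT hP hQ hp ha hpa).imp_right fun h' => ⟨h', hpa⟩
    · rintro (rfl | ⟨ha, hpa⟩)
      · exact ⟨by simp [h.root.1], (mem_sideNbrs.1 (hP hp)).1.symm⟩
      · exact ⟨by simp [ha], hpa⟩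
  rw [this, Finset.card_insert_of_notMem]
  intro hv
  exact (not_side_of_mem hT h.adj hP hQ (Or.inr (Finset.mem_filter.1 hv).1)).1 rfl

lemma mem_left_of_adj (hT : T.IsTree) (h : IsStem T v w R) (hP : P ⊆ sideNbrs T v w)
    (hQ : Q ⊆ childrenOf T v P) {q b : V} (hq : q ∈ Q) (hb : b ∈ R ∪ P ∪ Q) (hqb : T.Adj q b) :
    b ∈ P := by
  have hd := dist_childrenOf hT hP (hQ hq)
  rw [Finset.mem_union, Finset.mem_union] at hb
  rcases hb with (hb | hb) | hb
  · exfalso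
    by_cases hbv : b = v
    · subst hbv
      rw [dist_eq_one_iff_adj.2 hqb.symm] at hd
      omega
    · have := h.mem_of_adj hT hP hQ hb hbv (by simp [hq]) hqb.symm
      exact Finset.disjoint_left.1 (h.disjoint hT hP hQ) this (by simp [hq])
  · exact hb
  · exact absurd (hd.trans (dist_childrenOf hT hP (hQ hb)).symm) (hT.dist_ne_of_adj v hqb)

lemma eq_of_adj_right (hT : T.IsTree) (hP : P ⊆ sideNbrs T v w)
    (hQ : Q ⊆ childrenOf T v P) {p p' q : V} (hq : q ∈ Q) (hp : p ∈ P) (hp' : p' ∈ P)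
    (h1 : T.Adj q p) (h2 : T.Adj q p') : p = p' := by
  have hd := dist_childrenOf hT hP (hQ hq)
  apply eq_of_adj_of_dist_lt hT (v := v) h1 h2
  · rw [dist_sideNbrs (hP hp), hd]; exact one_lt_two
  · rw [dist_sideNbrs (hP hp'), hd]; exact one_lt_two

lemma degIn_right (hT : T.IsTree) (h : IsStem T v w R) (hP : P ⊆ sideNbrs T v w)
    (hQ : Q ⊆ childrenOf T v P) {q : V} (hq : q ∈ Q) :
    degIn T (R ∪ P ∪ Q) q = 1 := by
  unfold degIn
  rw [Finset.card_eq_one]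
  obtain ⟨p, hp, hpq, -⟩ := mem_childrenOf.1 (hQ hq)
  refine ⟨p, ?_⟩
  ext a
  simp only [Finset.mem_filter, Finset.mem_singleton]
  constructor
  · rintro ⟨ha, hqa⟩
    exact eq_of_adj_right hT hP hQ hq (h.mem_left_of_adj hT hP hQ hq ha hqa) hp hqa hpq.symm
  · rintro rfl
    exact ⟨by simp [hp], hpq.symm⟩

lemma card_leavesIn (hT : T.IsTree) (h : IsStem T v w R) (hP : P ⊆ sideNbrs T v w)
    (hQ : Q ⊆ childrenOf T v P) (hP0 : P.Nonempty) :
    (leavesIn T (R ∪ P ∪ Q)).card = (R.filter fun a => a ≠ v ∧ degIn T R a = 1).card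
      + (P.filter fun p => ∀ q ∈ Q, ¬ T.Adj p q).card + Q.card := by
  have h1 := h.disjoint hT hP hQ
  have h2 := disjoint' hT hP hQ
  have : leavesIn T (R ∪ P ∪ Q) = (R.filter fun a => a ≠ v ∧ degIn T R a = 1) ∪
      ((P.filter fun p => ∀ q ∈ Q, ¬ T.Adj p q) ∪ Q) := by
    rw [leavesIn, Finset.filter_union, Finset.filter_union]
    refine (Finset.union_assoc _ _ _).trans ?_
    congr 1
    · apply Finset.filter_congr
      intro a ha
      by_cases hav : a = v
      · subst hav
        have := hP0.card_pos
        rw [h.degIn_root hT hP hQ]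
        refine ⟨fun h' => ?_, fun h' => absurd rfl h'.1⟩
        omega
      · rw [h.degIn_core hT hP hQ ha hav]; simp [hav]
    · congr 1
      · apply Finset.filter_congr
        intro p hp
        rw [h.degIn_left hT hP hQ hp]
        simp [Finset.filter_eq_empty_iff]
      · rw [Finset.filter_eq_self]
        exact fun q hq => h.degIn_right hT hP hQ hq
  rw [this, Finset.card_union_of_disjoint, Finset.card_union_of_disjoint, add_assoc]
  · exact h2.mono_left (Finset.filter_subset _ _)
  · exact h1.mono (Finset.filter_subset _ _)
      (Finset.union_subset_union_left (Finset.filter_subset _ _))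

end IsStem
end Stem

section Core
open scoped Classical
variable {V : Type*} [Fintype V] (T : SimpleGraph V)

/-- The part of a copy of the caterpillar that is left after removing, at the vertex `v`, the
fork of order one and the `d` adjacent leaves. The copy has `k` vertices, `l` leaves and `m`
leaves with a neighbour of degree two. -/
structure IsCore (k d l m : ℕ) (v w : V) (R : Finset V) : Prop extends IsStem T v w R where
  card : R.card + d + 2 = k
  leaves : (R.filter fun a => a ≠ v ∧ degIn T R a = 1).card + d + 1 = l
  deepLeaves : (R.filter fun a => a ≠ v ∧ degIn T R a = 1 ∧
    ∃ b ∈ R, b ≠ v ∧ T.Adj a b ∧ degIn T R b = 2).card + 1 = m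
  inner : ∃ z ∈ R, z ≠ v ∧ T.Adj w z ∧ 2 ≤ degIn T R z
  caterpillar : ∀ a ∈ R, a ≠ v → ∀ b₁ ∈ R, ∀ b₂ ∈ R, ∀ b₃ ∈ R, T.Adj a b₁ → T.Adj a b₂ →
    T.Adj a b₃ → (b₁ = v ∨ 2 ≤ degIn T R b₁) → (b₂ = v ∨ 2 ≤ degIn T R b₂) →
    (b₃ = v ∨ 2 ≤ degIn T R b₃) → b₁ ≠ b₂ → b₁ ≠ b₃ → b₂ ≠ b₃ → False

variable {T} {v w : V} {R P Q : Finset V}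

lemma IsStem.card_deepLeavesIn (hT : T.IsTree) (h : IsStem T v w R) (hP : P ⊆ sideNbrs T v w)
    (hQ : Q ⊆ childrenOf T v P) (hP0 : P.Nonempty) (hw : 2 ≤ degIn T R w)
    (hP1 : P.card ≠ 1 ∨ ∀ p ∈ P, ∃ q ∈ Q, T.Adj p q) :
    (deepLeavesIn T (R ∪ P ∪ Q)).card = (R.filter fun a => a ≠ v ∧ degIn T R a = 1 ∧
      ∃ b ∈ R, b ≠ v ∧ T.Adj a b ∧ degIn T R b = 2).card
      + (Q.filter fun q => ∃ p ∈ P, T.Adj q p ∧ (Q.filter (T.Adj p)).card = 1).card := by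
  have h1 := h.disjoint hT hP hQ
  have hv : degIn T (R ∪ P ∪ Q) v = P.card + 1 := h.degIn_root hT hP hQ
  have hpos := hP0.card_pos
  have : deepLeavesIn T (R ∪ P ∪ Q) = (R.filter fun a => a ≠ v ∧ degIn T R a = 1 ∧
      ∃ b ∈ R, b ≠ v ∧ T.Adj a b ∧ degIn T R b = 2) ∪
      (Q.filter fun q => ∃ p ∈ P, T.Adj q p ∧ (Q.filter (T.Adj p)).card = 1) := by
    ext a
    rw [deepLeavesIn, Finset.mem_filter, Finset.mem_union (s := R.filter _), Finset.mem_filter,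
      Finset.mem_filter]
    constructor
    · rintro ⟨ha, ha1, b, hb, hab, hb2⟩
      have ha' := ha
      rw [Finset.mem_union, Finset.mem_union] at ha
      rcases ha with (ha | ha) | ha
      · left
        by_cases hav : a = v
        · subst hav; omega
        rw [h.degIn_core hT hP hQ ha hav] at ha1
        have hbR := h.mem_of_adj hT hP hQ ha hav hb hab
        have hbv : b ≠ v := by
          rintro rfl
          have := (eq_of_adj_of_sides hT h.adj hab (h.side a ha hav) (by simp)).1
          subst this; omega
        rw [h.degIn_core hT hP hQ hbR hbv] at hb2
        exact ⟨ha, hav, ha1, b, hbR, hbv, hab, hb2⟩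
      · exfalso
        rcases h.adj_of_mem_left hT hP hQ ha hb hab with rfl | hbQ
        · rw [hv] at hb2
          rcases hP1 with hP1 | hP1
          · omega
          · obtain ⟨q, hq, haq⟩ := hP1 a ha
            have := eq_of_degIn_eq_one ha1 hb (by simp [hq]) hab haq
            exact (not_side_of_mem hT h.adj hP hQ (Or.inr hq)).1 this.symm
        · have := h.degIn_right hT hP hQ hbQ
          omega
      · right
        have hbP := h.mem_left_of_adj hT hP hQ ha hb hab
        rw [h.degIn_left hT hP hQ hbP] at hb2
        exact ⟨ha, b, hbP, hab, by omega⟩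
    · rintro (⟨ha, hav, ha1, b, hb, hbv, hab, hb2⟩ | ⟨ha, b, hb, hab, hb2⟩)
      · rw [h.degIn_core hT hP hQ ha hav]
        refine ⟨by simp [ha], ha1, b, by simp [hb], hab, ?_⟩
        rwa [h.degIn_core hT hP hQ hb hbv]
      · refine ⟨by simp [ha], h.degIn_right hT hP hQ ha, b, by simp [hb], hab, ?_⟩
        rw [h.degIn_left hT hP hQ hb, hb2]
  rw [this, Finset.card_union_of_disjoint]
  exact h1.mono (Finset.filter_subset _ _)
    ((Finset.filter_subset _ _).trans Finset.subset_union_right)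

section Counts
variable {k d l m : ℕ}

lemma IsCore.two_le_degIn {V : Type*} {T : SimpleGraph V} {v w : V} {R : Finset V}
    (h : IsCore T k d l m v w R) : 2 ≤ degIn T R w := by
  obtain ⟨z, hz, hzv, hwz, -⟩ := h.inner
  exact _root_.two_le_degIn hz h.root.1 hwz h.adj.symm hzv

lemma IsCore.card_leavesIn_union (hT : T.IsTree) (h : IsCore T k d l m v w R)
    (hP : P ⊆ sideNbrs T v w) (hP0 : P.Nonempty) :
    (leavesIn T (R ∪ P)).card + d + 1 = l + P.card := by
  have := h.card_leavesIn hT hP (Q := ∅) (by simp) hP0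
  have h2 := h.leaves
  simp only [Finset.union_empty, Finset.notMem_empty, false_imp_iff, implies_true,
    Finset.filter_true, Finset.card_empty, add_zero] at this
  omega

lemma IsCore.leaves_or_deepLeaves_ne (hT : T.IsTree) (h : IsCore T k d l m v w R)
    (hP : P ∈ (sideNbrs T v w).powersetCard d) (hQ : Q ∈ (childrenOf T v P).powersetCard 2) :
    (leavesIn T (R ∪ P ∪ Q)).card ≠ l ∨ (deepLeavesIn T (R ∪ P ∪ Q)).card ≠ m := by
  rw [Finset.mem_powersetCard] at hP hQ
  obtain ⟨hP, hPc⟩ := hP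
  obtain ⟨hQ, hQc⟩ := hQ
  obtain ⟨q₁, q₂, hq, rfl⟩ := Finset.card_eq_two.1 hQc
  obtain ⟨p₁, hp₁, hpq₁, -⟩ := mem_childrenOf.1 (hQ (Finset.mem_insert_self _ _))
  obtain ⟨p₂, hp₂, hpq₂, -⟩ := mem_childrenOf.1
    (hQ (Finset.mem_insert_of_mem (Finset.mem_singleton_self q₂)))
  have hP0 : P.Nonempty := ⟨p₁, hp₁⟩
  have huniq₁ : ∀ p ∈ P, T.Adj p q₁ → p = p₁ := fun p hp hpq =>
    IsStem.eq_of_adj_right hT hP hQ (q := q₁) (by simp) hp hp₁ hpq.symm hpq₁.symm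
  have huniq₂ : ∀ p ∈ P, T.Adj p q₂ → p = p₂ := fun p hp hpq =>
    IsStem.eq_of_adj_right hT hP hQ (q := q₂) (by simp) hp hp₂ hpq.symm hpq₂.symm
  by_cases hp : p₁ = p₂
  · right
    subst hp
    have hcond : P.card ≠ 1 ∨ ∀ p ∈ P, ∃ q ∈ ({q₁, q₂} : Finset V), T.Adj p q := by
      by_cases h1 : P.card = 1
      · right
        intro p hp
        rw [Finset.card_le_one.1 h1.le p hp p₁ hp₁]
        exact ⟨q₁, by simp, hpq₁⟩
      · exact Or.inl h1
    rw [h.card_deepLeavesIn hT hP hQ hP0 h.two_le_degIn hcond, ← h.deepLeaves]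
    have : ({q₁, q₂} : Finset V).filter (fun q => ∃ p ∈ P, T.Adj q p ∧
        (({q₁, q₂} : Finset V).filter (T.Adj p)).card = 1) = ∅ := by
      rw [Finset.filter_eq_empty_iff]
      rintro q hq' ⟨p, hp, hqp, hc⟩
      have : p = p₁ := by
        rcases Finset.mem_insert.1 hq' with rfl | hq'
        · exact huniq₁ p hp hqp.symm
        · rw [Finset.mem_singleton] at hq'
          subst hq'; exact huniq₂ p hp hqp.symm
      subst this
      have := Finset.one_lt_card.2 ⟨q₁, Finset.mem_filter.2 ⟨Finset.mem_insert_self _ _, hpq₁⟩, q₂,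
        Finset.mem_filter.2 ⟨Finset.mem_insert_of_mem (Finset.mem_singleton_self _), hpq₂⟩, hq⟩
      exact absurd hc this.ne'
    rw [this]
    simp
  · left
    rw [h.card_leavesIn hT hP hQ hP0, hQc, ← h.leaves]
    have : P.filter (fun p => ∀ q ∈ ({q₁, q₂} : Finset V), ¬ T.Adj p q) = P \ {p₁, p₂} := by
      ext p
      simp only [Finset.mem_filter, Finset.mem_insert, Finset.mem_singleton, Finset.mem_sdiff,
        forall_eq_or_imp, forall_eq, not_or]
      refine and_congr_right fun hp => ⟨fun h' => ⟨?_, ?_⟩, fun h' => ⟨?_, ?_⟩⟩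
      · rintro rfl; exact h'.1 hpq₁
      · rintro rfl; exact h'.2 hpq₂
      · exact fun h'' => h'.1 (huniq₁ p hp h'')
      · exact fun h'' => h'.2 (huniq₂ p hp h'')
    have hsub : ({p₁, p₂} : Finset V) ⊆ P := by
      intro p hp; simp only [Finset.mem_insert, Finset.mem_singleton] at hp
      rcases hp with rfl | rfl <;> assumption
    have h2 := Finset.card_le_card hsub
    rw [this, Finset.card_sdiff_of_subset hsub]
    rw [Finset.card_pair hp] at *
    omega

end Counts

section Transport
variable {W : Type*} [Fintype W] {S : SimpleGraph W} {s : Finset V}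

lemma ndeg_eq_degIn (S : SimpleGraph W) (a : W) : ndeg S a = degIn S Finset.univ a := by
  rw [ndeg, degIn, ← Set.ncard_coe_finset]
  congr 1
  ext b
  simp

/-- An isomorphism between `S` and the subgraph induced by `s`, as a map into `V`. -/
lemma exists_map_of_iso {V : Type*} {T : SimpleGraph V} {s : Finset V}
    (h : Nonempty ((T.induce (s : Set V)) ≃g S)) :
    ∃ f : W → V, Function.Injective f ∧ Finset.univ.image f = s ∧
      (∀ a b, T.Adj (f a) (f b) ↔ S.Adj a b) ∧
      ∀ a, degIn T s (f a) = degIn S Finset.univ a := by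
  obtain ⟨e⟩ := h
  have hinj : Function.Injective fun a => (e.symm a : V) := by
    intro a b hab
    exact e.symm.injective (Subtype.ext hab)
  have hadj : ∀ a b, T.Adj (e.symm a : V) (e.symm b : V) ↔ S.Adj a b := by
    intro a b
    rw [← e.symm.map_adj_iff (v := a) (w := b)]
    rfl
  have him : Finset.univ.image (fun a => (e.symm a : V)) = s := by
    ext a
    simp only [Finset.mem_image, Finset.mem_univ, true_and]
    constructor
    · rintro ⟨b, rfl⟩; exact (e.symm b).2
    · exact fun ha => ⟨e ⟨a, ha⟩, by simp⟩
  refine ⟨_, hinj, him, hadj, fun a => ?_⟩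
  unfold degIn
  rw [← Finset.card_image_of_injective _ hinj]
  congr 1
  ext b
  simp only [Finset.mem_filter, Finset.mem_image, Finset.mem_univ, true_and]
  constructor
  · rintro ⟨hb, hab⟩
    rw [← him] at hb
    obtain ⟨c, -, rfl⟩ := Finset.mem_image.1 hb
    exact ⟨c, (hadj a c).1 hab, rfl⟩
  · rintro ⟨c, hc, rfl⟩
    exact ⟨(e.symm c).2, (hadj a c).2 hc⟩

lemma card_leavesIn_of_iso (h : Nonempty ((T.induce (s : Set V)) ≃g S)) :
    (leavesIn T s).card = (leavesIn S Finset.univ).card ∧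
    (deepLeavesIn T s).card = (deepLeavesIn S Finset.univ).card := by
  obtain ⟨f, hinj, him, hadj, hdeg⟩ := exists_map_of_iso h
  subst him
  constructor
  · rw [← Finset.card_image_of_injective (leavesIn S Finset.univ) hinj]
    congr 1
    ext a
    simp only [leavesIn, Finset.mem_filter, Finset.mem_image, Finset.mem_univ, true_and]
    constructor
    · rintro ⟨⟨b, rfl⟩, hb⟩
      exact ⟨b, hdeg b ▸ hb, rfl⟩
    · rintro ⟨b, hb, rfl⟩
      exact ⟨⟨b, rfl⟩, (hdeg b).trans hb⟩
  · rw [← Finset.card_image_of_injective (deepLeavesIn S Finset.univ) hinj]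
    congr 1
    ext a
    simp only [deepLeavesIn, Finset.mem_filter, Finset.mem_image, Finset.mem_univ, true_and]
    constructor
    · rintro ⟨⟨b, rfl⟩, hb, _, ⟨c, rfl⟩, hbc, hc⟩
      exact ⟨b, ⟨hdeg b ▸ hb, c, (hadj b c).1 hbc, hdeg c ▸ hc⟩, rfl⟩
    · rintro ⟨b, ⟨hb, c, hbc, hc⟩, rfl⟩
      exact ⟨⟨b, rfl⟩, (hdeg b).trans hb, f c, ⟨c, rfl⟩, (hadj b c).2 hbc, (hdeg c).trans hc⟩

end Transport
end Core

section Shape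
open scoped Classical
variable {V W : Type*}

/-- In the subgraph of `G` induced by `s`, the vertex `v` is the root of the fork `{u, x}` of
order one and of one more non-trivial branch through `w`, and is adjacent to `d` leaves. -/
structure IsForkRoot (G : SimpleGraph V) (s : Finset V) (d : ℕ) (v u x w z : V) : Prop where
  root_mem : v ∈ s
  center_mem : u ∈ s
  tip_mem : x ∈ s
  next_mem : w ∈ s
  next'_mem : z ∈ s
  adj_center : G.Adj v u
  adj_tip : G.Adj u x
  adj_next : G.Adj v w
  adj_next' : G.Adj w z
  tip_ne : x ≠ v
  next_ne : w ≠ u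
  next'_ne : z ≠ v
  degIn_center : degIn G s u = 2
  degIn_tip : degIn G s x = 1
  degIn_next' : 2 ≤ degIn G s z
  degIn_root : degIn G s v = d + 2
  degIn_leaf : ∀ y ∈ s, G.Adj v y → y ≠ u → y ≠ w → degIn G s y = 1
  caterpillar : ∀ a ∈ s, ∀ b₁ ∈ s, ∀ b₂ ∈ s, ∀ b₃ ∈ s, G.Adj a b₁ → G.Adj a b₂ → G.Adj a b₃ →
    2 ≤ degIn G s b₁ → 2 ≤ degIn G s b₂ → 2 ≤ degIn G s b₃ → b₁ ≠ b₂ → b₁ ≠ b₃ → b₂ ≠ b₃ → False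

lemma IsForkRoot.map {T : SimpleGraph V} [Fintype W] {S : SimpleGraph W} {d : ℕ} {v u x w z : W}
    (h : IsForkRoot S Finset.univ d v u x w z) {s : Finset V} {f : W → V}
    (hinj : Function.Injective f) (him : Finset.univ.image f = s)
    (hadj : ∀ a b, T.Adj (f a) (f b) ↔ S.Adj a b)
    (hdeg : ∀ a, degIn T s (f a) = degIn S Finset.univ a) :
    IsForkRoot T s d (f v) (f u) (f x) (f w) (f z) := by
  have hmem : ∀ a, f a ∈ s := fun a => him ▸ Finset.mem_image_of_mem f (Finset.mem_univ a)
  have hsurj : ∀ a ∈ s, ∃ b, f b = a := fun a ha => by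
    rw [← him] at ha
    obtain ⟨b, -, hb⟩ := Finset.mem_image.1 ha
    exact ⟨b, hb⟩
  refine ⟨hmem _, hmem _, hmem _, hmem _, hmem _, (hadj _ _).2 h.adj_center, (hadj _ _).2 h.adj_tip,
    (hadj _ _).2 h.adj_next, (hadj _ _).2 h.adj_next', hinj.ne h.tip_ne, hinj.ne h.next_ne,
    hinj.ne h.next'_ne, (hdeg _).trans h.degIn_center, (hdeg _).trans h.degIn_tip,
    h.degIn_next'.trans_eq (hdeg _).symm, (hdeg _).trans h.degIn_root, ?_, ?_⟩
  · intro y hy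
    obtain ⟨y, rfl⟩ := hsurj y hy
    rw [hadj, hinj.ne_iff, hinj.ne_iff, hdeg]
    exact h.degIn_leaf y (Finset.mem_univ _)
  · intro a ha b₁ hb₁ b₂ hb₂ b₃ hb₃
    obtain ⟨a, rfl⟩ := hsurj a ha
    obtain ⟨b₁, rfl⟩ := hsurj b₁ hb₁
    obtain ⟨b₂, rfl⟩ := hsurj b₂ hb₂
    obtain ⟨b₃, rfl⟩ := hsurj b₃ hb₃
    simp only [hadj, hdeg, hinj.ne_iff]
    exact h.caterpillar a (Finset.mem_univ _) b₁ (Finset.mem_univ _) b₂ (Finset.mem_univ _) b₃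
      (Finset.mem_univ _)

lemma mem_branchSet_of_adj {G : SimpleGraph V} {v u y : V} (huv : u ≠ v) (h : G.Adj u y)
    (hy : y ≠ v) : y ∈ branchSet G v u :=
  ⟨Walk.cons h Walk.nil, by simp [huv.symm, hy.symm]⟩

variable [Fintype W] {S : SimpleGraph W}

lemma nontrivialBranch_of_two_le_degIn {a b : W} (hab : S.Adj a b)
    (h : 2 ≤ degIn S Finset.univ b) : NontrivialBranch S a b := by
  refine ⟨hab, fun heq => ?_⟩
  obtain ⟨c, -, hbc, hca⟩ := exists_adj_of_two_le_degIn h a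
  have := mem_branchSet_of_adj hab.ne' hbc hca
  rw [heq] at this
  exact hbc.ne' this

lemma IsCaterpillar.false_of_three (hS : IsCaterpillar S) {a b₁ b₂ b₃ : W} (h₁ : S.Adj a b₁)
    (h₂ : S.Adj a b₂) (h₃ : S.Adj a b₃) (hd₁ : 2 ≤ degIn S Finset.univ b₁)
    (hd₂ : 2 ≤ degIn S Finset.univ b₂) (hd₃ : 2 ≤ degIn S Finset.univ b₃) (h₁₂ : b₁ ≠ b₂)
    (h₁₃ : b₁ ≠ b₃) (h₂₃ : b₂ ≠ b₃) : False := by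
  have h := hS.2 a
  have hsub : (({b₁, b₂, b₃} : Finset W) : Set W) ⊆ {u | NontrivialBranch S a u} := by
    intro b hb
    simp only [Finset.coe_insert, Finset.coe_singleton, Set.mem_insert_iff,
      Set.mem_singleton_iff] at hb
    rcases hb with rfl | rfl | rfl
    · exact nontrivialBranch_of_two_le_degIn h₁ hd₁
    · exact nontrivialBranch_of_two_le_degIn h₂ hd₂
    · exact nontrivialBranch_of_two_le_degIn h₃ hd₃
  have := Set.ncard_le_ncard hsub (Set.toFinite _)
  rw [Set.ncard_coe_finset, Finset.card_eq_three.2 ⟨b₁, b₂, b₃, h₁₂, h₁₃, h₂₃, rfl⟩] at this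
  omega

lemma one_le_degIn {a b : W} (h : S.Adj a b) : 1 ≤ degIn S Finset.univ a :=
  Finset.card_pos.2 ⟨b, by simp [h]⟩

lemma IsFork.exists_tip {v u : W} (h : IsFork S v u) (ho : forkOrder S v u = 1) :
    ∃ x, S.Adj u x ∧ x ≠ v ∧ degIn S Finset.univ u = 2 ∧ degIn S Finset.univ x = 1 := by
  have huv : u ≠ v := h.1.1.ne'
  have hcard : (branchSet S v u).ncard = 2 := by unfold forkOrder at ho; omega
  have hu : u ∈ branchSet S v u := ⟨Walk.nil, by simp [huv.symm]⟩
  obtain ⟨x, hx, hxu⟩ := Set.exists_ne_of_one_lt_ncard (by omega : 1 < (branchSet S v u).ncard) u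
  have heq : ({u, x} : Set W) = branchSet S v u := by
    refine Set.eq_of_subset_of_ncard_le ?_ ?_ (Set.toFinite _)
    · rintro y (rfl | rfl) <;> assumption
    · rw [hcard, Set.ncard_pair hxu.symm]
  have hnbr : ∀ y, S.Adj u y → y ≠ v → y = x := by
    intro y hy hyv
    have := mem_branchSet_of_adj huv hy hyv
    rw [← heq] at this
    exact this.resolve_left hy.ne'
  have hadj : S.Adj u x := by
    obtain ⟨p, hp⟩ := hx
    cases p with
    | nil => exact absurd rfl hxu
    | cons hub q =>
      rename_i b
      have hbv : b ≠ v := by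
        rintro rfl
        exact hp (by simp)
      rwa [← hnbr b hub hbv]
  have hxv : x ≠ v := by
    obtain ⟨p, hp⟩ := hx
    rintro rfl
    exact hp (by simp)
  refine ⟨x, hadj, hxv, ?_, ?_⟩
  · unfold degIn
    rw [Finset.card_eq_two]
    refine ⟨v, x, hxv.symm, ?_⟩
    ext y
    simp only [Finset.mem_filter, Finset.mem_univ, true_and, Finset.mem_insert,
      Finset.mem_singleton]
    constructor
    · intro hy
      by_cases hyv : y = v
      · exact Or.inl hyv
      · exact Or.inr (hnbr y hy hyv)
    · rintro (rfl | rfl)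
      · exact h.1.1.symm
      · exact hadj
  · rw [← ndeg_eq_degIn]
    exact h.2 x hx hxu

lemma IsCaterpillar.exists_isForkRoot (hS : IsCaterpillar S)
    (hint : 4 ≤ {v | ndeg S v ≠ 1}.ncard) {v : W}
    (hfork : ∃ u, IsFork S v u ∧ forkOrder S v u = 1)
    (hleaf : ∃ u, S.Adj v u ∧ ndeg S u = 1) :
    ∃ d u x w z, 1 ≤ d ∧ IsForkRoot S Finset.univ d v u x w z := by
  obtain ⟨u, hu, hou⟩ := hfork
  obtain ⟨x, hux, hxv, hdu, hdx⟩ := hu.exists_tip hou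
  have hvu := hu.1.1
  obtain ⟨w, z, hvw, hwu, hwz, hzv, hdz⟩ : ∃ w z, S.Adj v w ∧ w ≠ u ∧ S.Adj w z ∧ z ≠ v ∧
      2 ≤ degIn S Finset.univ z := by
    by_contra! hcon
    have hdeg : ∀ w z, S.Adj v w → S.Adj w z → z ≠ v → degIn S Finset.univ z = 1 := by
      intro w z hvw hwz hzv
      by_cases hwu : w = u
      · subst hwu
        by_cases hzx : z = x
        · rw [hzx, hdx]
        · exfalso
          have : 2 < degIn S Finset.univ w := Finset.two_lt_card.2
            ⟨v, by simp [hvw.symm], x, by simp [hux], z, by simp [hwz], hxv.symm, hzv.symm,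
              Ne.symm hzx⟩
          omega
      · have := hcon w z hvw hwu hwz hzv
        have := one_le_degIn hwz.symm
        omega
    have key : ∀ n a, S.dist v a = n → a = v ∨ S.Adj v a ∨
        ∃ w, S.Adj v w ∧ S.Adj w a ∧ a ≠ v := by
      intro n
      induction n using Nat.strong_induction_on with
      | _ n ih =>
        intro a ha
        by_cases hav : a = v
        · exact Or.inl hav
        obtain ⟨b, hab, hd⟩ := exists_adj_dist_lt hS.1.connected hav
        rcases ih _ (by omega) b rfl with rfl | hb | ⟨w, hvw, hwb, hbv⟩
        · exact Or.inr (Or.inl hab.symm)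
        · exact Or.inr (Or.inr ⟨b, hb, hab.symm, hav⟩)
        · have := eq_of_degIn_eq_one (hdeg w b hvw hwb hbv) (Finset.mem_univ _) (Finset.mem_univ _)
            hab.symm hwb.symm
          subst this
          exact Or.inr (Or.inl hvw)
    have hsub : {a | ndeg S a ≠ 1} ⊆
        ((insert v (Finset.univ.filter fun a => S.Adj v a ∧ 2 ≤ degIn S Finset.univ a) :
          Finset W) : Set W) := by
      intro a ha
      rw [Set.mem_ofPred_eq, ndeg_eq_degIn] at ha
      simp only [Finset.coe_insert, Finset.coe_filter, Finset.mem_univ, true_and,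
        Set.mem_insert_iff, Set.mem_ofPred_eq]
      rcases key _ a rfl with h | h | ⟨w, hvw, hwa, hav⟩
      · exact Or.inl h
      · have := one_le_degIn h.symm
        exact Or.inr ⟨h, by omega⟩
      · exact absurd (hdeg w a hvw hwa hav) ha
    have h1 := Set.ncard_le_ncard hsub (Set.toFinite _)
    rw [Set.ncard_coe_finset] at h1
    have h2 := Finset.card_insert_le v
      (Finset.univ.filter fun a => S.Adj v a ∧ 2 ≤ degIn S Finset.univ a)
    obtain ⟨b₁, b₂, b₃, hb₁, hb₂, hb₃, h₁₂, h₁₃, h₂₃⟩ := Finset.two_lt_card_iff.1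
      (show 2 < (Finset.univ.filter fun a => S.Adj v a ∧ 2 ≤ degIn S Finset.univ a).card by omega)
    simp only [Finset.mem_filter, Finset.mem_univ, true_and] at hb₁ hb₂ hb₃
    exact hS.false_of_three hb₁.1 hb₂.1 hb₃.1 hb₁.2 hb₂.2 hb₃.2 h₁₂ h₁₃ h₂₃
  have hdw : 2 ≤ degIn S Finset.univ w :=
    two_le_degIn (Finset.mem_univ _) (Finset.mem_univ _) hvw.symm hwz hzv.symm
  obtain ⟨y, hvy, hdy⟩ := hleaf
  rw [ndeg_eq_degIn] at hdy
  have h3 : 2 < degIn S Finset.univ v := Finset.two_lt_card.2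
    ⟨u, by simp [hvu], w, by simp [hvw], y, by simp [hvy], hwu.symm,
      by rintro rfl; omega, by rintro rfl; omega⟩
  refine ⟨degIn S Finset.univ v - 2, u, x, w, z, by omega, Finset.mem_univ _, Finset.mem_univ _,
    Finset.mem_univ _, Finset.mem_univ _, Finset.mem_univ _, hvu, hux, hvw, hwz, hxv, hwu, hzv, hdu,
    hdx, hdz, by omega, ?_, ?_⟩
  · intro y _ hvy hyu hyw
    by_contra hne
    have := one_le_degIn hvy.symm
    exact hS.false_of_three hvu hvw hvy hdu.ge hdw (by omega) hwu.symm hyu.symm hyw.symm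
  · intro a _ b₁ _ b₂ _ b₃ _
    exact hS.false_of_three

end Shape

section Extraction
open scoped Classical
variable {V : Type*} [Fintype V] {T : SimpleGraph V}

lemma IsForkRoot.exists_isCore (hT : T.IsTree) {s : Finset V} {d : ℕ} {v u x w z : V}
    (h : IsForkRoot T s d v u x w z) (hd : 1 ≤ d) (hs : (T.induce (s : Set V)).Connected) :
    ∃ R P, IsCore T s.card d (leavesIn T s).card (deepLeavesIn T s).card v w R ∧
      P ∈ (sideNbrs T v w).powersetCard (d + 1) ∧ x ∈ childrenOf T v P ∧ s = R ∪ P ∪ {x} := by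
  have hroot := rootedAt_of_connected hT h.root_mem hs
  have hsw : T.dist w w < T.dist v w := by
    rw [dist_self, dist_eq_one_iff_adj.2 h.adj_next]; exact one_pos
  set R := insert v (s.filter fun a => T.dist w a < T.dist v a) with hR
  set P := (s.filter (T.Adj v)).erase w with hPdef
  have hRmem : ∀ a ∈ s, T.dist w a < T.dist v a → a ∈ R := fun a ha hlt =>
    Finset.mem_insert_of_mem (Finset.mem_filter.2 ⟨ha, hlt⟩)
  have hRside : ∀ a ∈ R, a ≠ v → a ∈ s ∧ T.dist w a < T.dist v a := fun a ha hav =>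
    Finset.mem_filter.1 ((Finset.mem_insert.1 ha).resolve_left hav)
  have hcross : ∀ a b, T.Adj a b → b ≠ v → T.dist w a < T.dist v a → T.dist w b < T.dist v b := by
    intro a b hab hbv ha
    by_contra hb
    exact hbv (eq_of_adj_of_sides hT h.adj_next hab ha hb).2
  have hstem : IsStem T v w R := by
    refine ⟨h.adj_next, ⟨Finset.mem_insert_self _ _, fun a ha hav => ?_⟩, hRmem w h.next_mem hsw,
      fun a ha hav => (hRside a ha hav).2⟩
    obtain ⟨has, hlt⟩ := hRside a ha hav
    obtain ⟨b, hb, hab, hd'⟩ := hroot.2 a has hav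
    refine ⟨b, ?_, hab, hd'⟩
    by_cases hbv : b = v
    · rw [hbv]; exact Finset.mem_insert_self _ _
    · exact hRmem b hb (hcross a b hab hbv hlt)
  have hPmem : ∀ a, a ∈ P ↔ a ≠ w ∧ a ∈ s ∧ T.Adj v a := by simp [hPdef]
  have hP : P ⊆ sideNbrs T v w := fun a ha =>
    mem_sideNbrs.2 ⟨((hPmem a).1 ha).2.2, ((hPmem a).1 ha).1⟩
  have huP : u ∈ P := (hPmem u).2 ⟨h.next_ne.symm, h.center_mem, h.adj_center⟩
  have hQ : ({x} : Finset V) ⊆ childrenOf T v P := by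
    rw [Finset.singleton_subset_iff, mem_childrenOf]
    exact ⟨u, huP, h.adj_tip, h.tip_ne⟩
  have hPc : P.card = d + 1 := by
    rw [hPdef, Finset.card_erase_of_mem (Finset.mem_filter.2 ⟨h.next_mem, h.adj_next⟩)]
    have := h.degIn_root
    unfold degIn at this
    omega
  have hleaf : ∀ p ∈ P, p ≠ u → degIn T s p = 1 := fun p hp hpu =>
    h.degIn_leaf p ((hPmem p).1 hp).2.1 ((hPmem p).1 hp).2.2 hpu ((hPmem p).1 hp).1
  have hu_nbr : ∀ a ∈ s, T.Adj u a → a ≠ v → a = x := by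
    intro a ha hua hav
    by_contra hax
    have : 2 < degIn T s u := Finset.two_lt_card.2
      ⟨v, Finset.mem_filter.2 ⟨h.root_mem, h.adj_center.symm⟩, x,
        Finset.mem_filter.2 ⟨h.tip_mem, h.adj_tip⟩, a, Finset.mem_filter.2 ⟨ha, hua⟩,
        h.tip_ne.symm, Ne.symm hav, Ne.symm hax⟩
    have := h.degIn_center
    omega
  have hs_eq : s = R ∪ P ∪ {x} := by
    have key : ∀ n, ∀ a ∈ s, T.dist v a = n → a ∈ R ∪ P ∪ {x} := by
      intro n
      induction n using Nat.strong_induction_on with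
      | _ n ih =>
        intro a ha hn
        by_cases hav : a = v
        · rw [hav]; simp [hR]
        obtain ⟨b, hb, hab, hlt⟩ := hroot.2 a ha hav
        have hb' := ih _ (by omega) b hb rfl
        rw [Finset.mem_union, Finset.mem_union, Finset.mem_singleton] at hb'
        rw [Finset.mem_union, Finset.mem_union, Finset.mem_singleton]
        rcases hb' with (hb' | hb') | rfl
        · by_cases hbv : b = v
          · subst hbv
            by_cases haw : a = w
            · exact Or.inl (Or.inl (haw ▸ hstem.mem))
            · exact Or.inl (Or.inr ((hPmem a).2 ⟨haw, ha, hab.symm⟩))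
          · exact Or.inl (Or.inl (hRmem a ha
              (hcross b a hab.symm hav (hRside b hb' hbv).2)))
        · by_cases hbu : b = u
          · subst hbu
            exact Or.inr (hu_nbr a ha hab.symm hav)
          · exact absurd (eq_of_degIn_eq_one (hleaf b hb' hbu) ha h.root_mem hab.symm
              ((hPmem b).1 hb').2.2.symm) hav
        · have := eq_of_degIn_eq_one h.degIn_tip ha h.center_mem hab.symm h.adj_tip.symm
          rw [this]
          exact Or.inl (Or.inr huP)
    apply Finset.Subset.antisymm
    · exact fun a ha => key _ a ha rfl
    · intro a ha
      rw [Finset.mem_union, Finset.mem_union, Finset.mem_singleton] at ha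
      rcases ha with (ha | ha) | rfl
      · by_cases hav : a = v
        · rw [hav]; exact h.root_mem
        · exact (hRside a ha hav).1
      · exact ((hPmem a).1 ha).2.1
      · exact h.tip_mem
  have hP0 : P.Nonempty := ⟨u, huP⟩
  have hzR : z ∈ R :=
    hRmem z h.next'_mem (hcross w z h.adj_next' h.next'_ne hsw)
  have hw2 : 2 ≤ degIn T R w :=
    two_le_degIn hzR hstem.root.1 h.adj_next' h.adj_next.symm h.next'_ne
  have hdeg : ∀ a ∈ R, a ≠ v → degIn T s a = degIn T R a := by
    intro a ha hav
    rw [hs_eq, hstem.degIn_core hT hP hQ ha hav]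
  have hRs : ∀ a ∈ R, a ∈ s := by
    intro a ha; rw [hs_eq]; simp [ha]
  have hxu : ∀ p ∈ P, T.Adj p x → p = u := fun p hp hpx =>
    IsStem.eq_of_adj_right hT hP hQ (Finset.mem_singleton_self x) hp huP hpx.symm h.adj_tip.symm
  refine ⟨R, P, ⟨hstem, ?_, ?_, ?_, ⟨z, hzR, h.next'_ne, h.adj_next', ?_⟩, ?_⟩,
    Finset.mem_powersetCard.2 ⟨hP, hPc⟩, hQ (Finset.mem_singleton_self x), hs_eq⟩
  · conv_rhs => rw [hs_eq, hstem.card_config hT hP hQ, hPc, Finset.card_singleton]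
    ring
  · conv_rhs => rw [hs_eq, hstem.card_leavesIn hT hP hQ hP0, Finset.card_singleton]
    have : (P.filter fun p => ∀ q ∈ ({x} : Finset V), ¬ T.Adj p q) = P.erase u := by
      ext p
      simp only [Finset.mem_filter, Finset.mem_singleton, forall_eq, Finset.mem_erase]
      constructor
      · rintro ⟨hp, hpx⟩
        exact ⟨fun hpu => hpx (hpu ▸ h.adj_tip), hp⟩
      · rintro ⟨hpu, hp⟩
        exact ⟨hp, fun hpx => hpu (hxu p hp hpx)⟩
    rw [this, Finset.card_erase_of_mem huP, hPc]
    rfl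
  · conv_rhs => rw [hs_eq, hstem.card_deepLeavesIn hT hP hQ hP0 hw2 (Or.inl (by omega))]
    have : ({x} : Finset V).filter (fun q => ∃ p ∈ P, T.Adj q p ∧
        (({x} : Finset V).filter (T.Adj p)).card = 1) = {x} := by
      rw [Finset.filter_eq_self]
      intro q hq
      rw [Finset.mem_singleton] at hq
      refine ⟨u, huP, hq ▸ h.adj_tip.symm, ?_⟩
      rw [Finset.filter_singleton, if_pos h.adj_tip, Finset.card_singleton]
    rw [this, Finset.card_singleton]
  · rw [← hdeg z hzR h.next'_ne]; exact h.degIn_next'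
  · intro a ha _ b₁ hb₁ b₂ hb₂ b₃ hb₃ h₁ h₂ h₃ hd₁ hd₂ hd₃
    have hd2 : ∀ b ∈ R, b = v ∨ 2 ≤ degIn T R b → 2 ≤ degIn T s b := by
      intro b hb hb'
      by_cases hbv : b = v
      · rw [hbv, h.degIn_root]; omega
      · rw [hdeg b hb hbv]; exact hb'.resolve_left hbv
    exact h.caterpillar a (hRs a ha) b₁ (hRs b₁ hb₁) b₂ (hRs b₂ hb₂) b₃ (hRs b₃ hb₃) h₁ h₂ h₃
      (hd2 b₁ hb₁ hd₁) (hd2 b₂ hb₂ hd₂) (hd2 b₃ hb₃ hd₃)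

end Extraction

section Multiplicity
open scoped Classical
variable {V : Type*} [Fintype V] (T : SimpleGraph V)

/-- The cores in `T`. -/
noncomputable def cores (k d l m : ℕ) : Finset (V × V × Finset V) :=
  Finset.univ.filter fun c => IsCore T k d l m c.1 c.2.1 c.2.2

/-- The vertex set `s` is obtained from the core `c` by attaching `p` vertices to its root and
`e` vertices to these. -/
def IsConfig (p e : ℕ) (c : V × V × Finset V) (s : Finset V) : Prop :=
  ∃ P ∈ (sideNbrs T c.1 c.2.1).powersetCard p, ∃ Q ∈ (childrenOf T c.1 P).powersetCard e,
    s = c.2.2 ∪ P ∪ Q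

variable {T} {k d l m p e : ℕ}

lemma IsCore.false_of_three (hT : T.IsTree) {v₁ w₁ v₂ w₂ v₃ w₃ : V} {R P Q : Finset V}
    (h : IsCore T k d l m v₁ w₁ R) (hP : P ⊆ sideNbrs T v₁ w₁) (hQ : Q ⊆ childrenOf T v₁ P)
    (hr₂ : RootedAt T v₂ (R ∪ P ∪ Q)) (hr₃ : RootedAt T v₃ (R ∪ P ∪ Q))
    (h₂ : v₂ ∈ R) (h₃ : v₃ ∈ R) (h₂₁ : v₂ ≠ v₁) (h₃₁ : v₃ ≠ v₁) (h₂₃ : v₂ ≠ v₃)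
    (hd₂ : 2 ≤ degIn T (R ∪ P ∪ Q) v₂) (hd₃ : 2 ≤ degIn T (R ∪ P ∪ Q) v₃)
    (hw₂ : T.Adj v₂ w₂) (hw₂₁ : T.dist w₂ v₁ < T.dist v₂ v₁) (hw₂₃ : T.dist w₂ v₃ < T.dist v₂ v₃)
    (hw₃ : T.Adj v₃ w₃) (hw₃₁ : T.dist w₃ v₁ < T.dist v₃ v₁) (hw₃₂ : T.dist w₃ v₂ < T.dist v₃ v₂) :
    False := by
  have hstem := h.toIsStem
  have hr₁ := hstem.rootedAt_config hT hP hQ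
  set s := R ∪ P ∪ Q with hs
  have hRs : ∀ a ∈ R, a ∈ s := fun a ha => by simp [hs, ha]
  have hmem : ∀ a ∈ R, a ≠ v₁ → ∀ b ∈ s, T.Adj a b → b ∈ R := fun a ha hav b hb hab =>
    hstem.mem_of_adj hT hP hQ ha hav hb hab
  have hstep : ∀ a b c, T.Adj a b → T.dist c a = T.dist c b + 1 ∨ T.dist c b = T.dist c a + 1 :=
    fun a b c hab => hT.dist_eq_dist_add_one_of_adj c hab
  obtain ⟨a, ha, hmin⟩ := Finset.exists_min_image (R.erase v₁)
    (fun a => T.dist v₁ a + T.dist v₂ a + T.dist v₃ a) ⟨v₂, Finset.mem_erase.2 ⟨h₂₁, h₂⟩⟩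
  rw [Finset.mem_erase] at ha
  obtain ⟨hav, ha⟩ := ha
  have hmin' : ∀ b ∈ s, T.Adj a b → b ≠ v₁ →
      T.dist v₁ a + T.dist v₂ a + T.dist v₃ a ≤ T.dist v₁ b + T.dist v₂ b + T.dist v₃ b :=
    fun b hb hab hbv => hmin b (Finset.mem_erase.2 ⟨hbv, hmem a ha hav b hb hab⟩)
  have hside : ∀ v ∈ R, v ≠ v₁ → ∀ b, T.Adj a b → T.dist v b < T.dist v a → b ≠ v₁ := by
    rintro v hv hvv b hab hlt rfl
    have := (eq_of_adj_of_sides hT h.adj hab (hstem.side a ha hav) (by simp)).1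
    subst this
    have := hstem.side v hv hvv
    rw [SimpleGraph.dist_comm, SimpleGraph.dist_comm (u := b)] at this
    omega
  have hdeg : ∀ v, RootedAt T v s → 2 ≤ degIn T s v → ∀ b ∈ R, T.Adj a b →
      T.dist v b < T.dist v a → b = v₁ ∨ 2 ≤ degIn T R b := by
    intro v hv hdv b hb hab hlt
    by_cases hbv₁ : b = v₁
    · exact Or.inl hbv₁
    right
    rw [← hstem.degIn_core hT hP hQ hb hbv₁]
    by_cases hbv : b = v
    · rw [hbv]; exact hdv
    · obtain ⟨c, hc, hbc, hlt'⟩ := hv.2 b (hRs b hb) hbv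
      exact _root_.two_le_degIn (hRs a ha) hc hab.symm hbc (by rintro rfl; omega)
  have hd₁ : v₁ ∈ s := hRs _ hstem.root.1
  obtain ⟨u₁, hu₁, hau₁, hlt₁⟩ := hr₁.2 a (hRs a ha) hav
  by_cases ha₂ : a = v₂
  · subst ha₂
    obtain ⟨u₃, hu₃, hau₃, hlt₃⟩ := hr₃.2 a (hRs a ha) h₂₃
    have e : u₃ = w₂ := eq_of_adj_of_dist_lt hT hau₃ hw₂ hlt₃
      (by rwa [SimpleGraph.dist_comm, SimpleGraph.dist_comm (v := a)])
    subst e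
    have := hmin' u₃ hu₃ hau₃ (hside v₃ h₃ h₃₁ u₃ hau₃ hlt₃)
    have e₂ := hstep a u₃ a hau₃
    rw [SimpleGraph.dist_comm, SimpleGraph.dist_comm (v := v₁)] at hw₂₁
    rw [dist_self] at *
    omega
  by_cases ha₃ : a = v₃
  · subst ha₃
    obtain ⟨u₂, hu₂, hau₂, hlt₂⟩ := hr₂.2 a (hRs a ha) h₂₃.symm
    have e : u₂ = w₃ := eq_of_adj_of_dist_lt hT hau₂ hw₃ hlt₂
      (by rwa [SimpleGraph.dist_comm, SimpleGraph.dist_comm (v := a)])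
    subst e
    have := hmin' u₂ hu₂ hau₂ (hside v₂ h₂ h₂₁ u₂ hau₂ hlt₂)
    have e₂ := hstep a u₂ a hau₂
    rw [SimpleGraph.dist_comm, SimpleGraph.dist_comm (v := v₁)] at hw₃₁
    rw [dist_self] at *
    omega
  obtain ⟨u₂, hu₂, hau₂, hlt₂⟩ := hr₂.2 a (hRs a ha) ha₂
  obtain ⟨u₃, hu₃, hau₃, hlt₃⟩ := hr₃.2 a (hRs a ha) ha₃
  have hn₂ := hside v₂ h₂ h₂₁ u₂ hau₂ hlt₂
  have hn₃ := hside v₃ h₃ h₃₁ u₃ hau₃ hlt₃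
  have m₂ := hmin' u₂ hu₂ hau₂ hn₂
  have m₃ := hmin' u₃ hu₃ hau₃ hn₃
  have hR₁ := hmem a ha hav u₁ hu₁ hau₁
  have hR₂ := hmem a ha hav u₂ hu₂ hau₂
  have hR₃ := hmem a ha hav u₃ hu₃ hau₃
  have hdv₁ : u₁ = v₁ ∨ 2 ≤ degIn T R u₁ := by
    by_cases hbv₁ : u₁ = v₁
    · exact Or.inl hbv₁
    · right
      rw [← hstem.degIn_core hT hP hQ hR₁ hbv₁]
      obtain ⟨c, hc, hbc, hlt'⟩ := hr₁.2 u₁ hu₁ hbv₁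
      exact _root_.two_le_degIn (hRs a ha) hc hau₁.symm hbc (by rintro rfl; omega)
  refine h.caterpillar a ha hav u₁ hR₁ u₂ hR₂ u₃ hR₃ hau₁ hau₂ hau₃ hdv₁
    (hdeg v₂ hr₂ hd₂ u₂ hR₂ hau₂ hlt₂) (hdeg v₃ hr₃ hd₃ u₃ hR₃ hau₃ hlt₃) ?_ ?_ ?_
  · rintro rfl
    have := hstep a u₁ v₃ hau₂
    omega
  · rintro rfl
    have := hstep a u₁ v₂ hau₃
    omega
  · rintro rfl
    have := hstep a u₂ v₁ hau₂
    omega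

lemma IsCore.eq_of_isConfig (hT : T.IsTree) {v w w' : V} {R R' : Finset V} {s : Finset V}
    (h : IsCore T k d l m v w R) (h' : IsCore T k d l m v w' R')
    (hs : IsConfig T p e (v, w, R) s) (hs' : IsConfig T p e (v, w', R') s) :
    w = w' ∧ R = R' := by
  obtain ⟨P, hP, Q, hQ, hsc⟩ := hs
  obtain ⟨P', hP', Q', hQ', hsc'⟩ := hs'
  replace hP := (Finset.mem_powersetCard.1 hP).1
  replace hQ := (Finset.mem_powersetCard.1 hQ).1
  replace hP' := (Finset.mem_powersetCard.1 hP').1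
  replace hQ' := (Finset.mem_powersetCard.1 hQ').1
  dsimp only at hP hQ hP' hQ' hsc hsc'
  have hww : w = w' := by
    by_contra hne
    have hws : w' ∈ R ∪ P ∪ Q := by rw [← hsc, hsc']; simp [h'.mem]
    have hw'P : w' ∈ P := by
      rw [Finset.mem_union, Finset.mem_union] at hws
      rcases hws with (hw | hw) | hw
      · exact absurd (eq_of_adj_of_sides hT h.adj h'.adj.symm (h.side w' hw h'.adj.ne')
          (by simp)).1.symm hne
      · exact hw
      · have := dist_childrenOf hT hP (hQ hw)
        rw [dist_eq_one_iff_adj.2 h'.adj] at this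
        omega
    obtain ⟨z, hz, hzv, hwz, hdz⟩ := h'.inner
    have hsub : R' ⊆ R ∪ P ∪ Q := by
      rw [← hsc, hsc']
      exact fun a ha => by simp [ha]
    rcases h.toIsStem.adj_of_mem_left hT hP hQ hw'P (hsub hz) hwz with hz' | hz'
    · exact hzv hz'
    · have h1 := h.toIsStem.degIn_right hT hP hQ hz'
      have h2 := degIn_mono (T := T) hsub z
      omega
  subst hww
  refine ⟨rfl, ?_⟩
  have key : ∀ {R R' P Q P' Q' : Finset V}, IsCore T k d l m v w R → IsCore T k d l m v w R' →
      P' ⊆ sideNbrs T v w → Q' ⊆ childrenOf T v P' → R ∪ P ∪ Q = R' ∪ P' ∪ Q' → R ⊆ R' := by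
    intro R R' P Q P' Q' h h' hP' hQ' heq a ha
    by_cases hav : a = v
    · rw [hav]; exact h'.root.1
    have ha' : a ∈ R' ∪ P' ∪ Q' := by rw [← heq]; simp [ha]
    rw [Finset.mem_union, Finset.mem_union, or_assoc] at ha'
    rcases ha' with ha' | ha'
    · exact ha'
    · exact absurd (h.side a ha hav) (not_side_of_mem hT h.adj hP' hQ' ha').2
  exact Finset.Subset.antisymm (key h h' hP' hQ' (hsc ▸ hsc')) (key h' h hP hQ (hsc' ▸ hsc))

lemma IsCore.root_mem_of_isConfig (hT : T.IsTree) (hp : 1 ≤ p) {v w v' w' : V}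
    {R R' P Q P' Q' : Finset V}
    (h : IsCore T k d l m v w R) (h' : IsCore T k d l m v' w' R')
    (hP : P ⊆ sideNbrs T v w) (hQ : Q ⊆ childrenOf T v P)
    (hP' : P' ∈ (sideNbrs T v' w').powersetCard p) (hQ' : Q' ⊆ childrenOf T v' P')
    (hQQ : Q.card = Q'.card) (heq : R ∪ P ∪ Q = R' ∪ P' ∪ Q') (hne : v' ≠ v) : v' ∈ R := by
  obtain ⟨hP', hPc⟩ := Finset.mem_powersetCard.1 hP'
  have hd' := h'.toIsStem.degIn_root hT hP' hQ'
  rw [← heq, hPc] at hd'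
  have hv' : v' ∈ R ∪ P ∪ Q := by rw [heq]; simp [h'.root.1]
  have hv'' := hv'
  rw [Finset.mem_union, Finset.mem_union] at hv'
  rcases hv' with (hv' | hv') | hv'
  · exact hv'
  · exfalso
    have hws : w' ∈ R ∪ P ∪ Q := by rw [heq]; simp [h'.mem]
    have hwv : w' = v := by
      refine (h.toIsStem.adj_of_mem_left hT hP hQ hv' hws h'.adj).resolve_right fun hw'Q => ?_
      have h1 := h.toIsStem.degIn_right hT hP hQ hw'Q
      have h2 := h'.two_le_degIn
      have h3 : R' ⊆ R ∪ P ∪ Q := by rw [heq]; exact fun a ha => by simp [ha]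
      have h4 := degIn_mono (T := T) h3 w'
      omega
    subst hwv
    have hP'Q : ∀ q ∈ P', q ∈ Q := by
      intro q hq
      have hq' := mem_sideNbrs.1 (hP' hq)
      exact (h.toIsStem.adj_of_mem_left hT hP hQ hv' (by rw [heq]; simp [hq]) hq'.1).resolve_left
        hq'.2
    obtain ⟨q, hq⟩ := Finset.card_pos.1 (show 0 < P'.card by omega)
    have hQpos := Finset.card_pos.2 ⟨q, hP'Q q hq⟩
    obtain ⟨r, hr⟩ := Finset.card_pos.1 (hQQ ▸ hQpos)
    obtain ⟨q, hq, hqr, hrv⟩ := mem_childrenOf.1 (hQ' hr)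
    have h1 := h.toIsStem.degIn_right hT hP hQ (hP'Q q hq)
    have h2 : 2 ≤ degIn T (R ∪ P ∪ Q) q := _root_.two_le_degIn (by rw [heq]; simp [hr])
      hv'' hqr (mem_sideNbrs.1 (hP' hq)).1.symm hrv
    omega
  · have := h.toIsStem.degIn_right hT hP hQ hv'
    omega

lemma card_filter_isConfig_le (hT : T.IsTree) (hp : 1 ≤ p) (s : Finset V) :
    ((cores T k d l m).filter fun c => IsConfig T p e c s).card ≤ 2 := by
  by_contra! hlt
  obtain ⟨c₁, c₂, c₃, hc₁, hc₂, hc₃, h₁₂, h₁₃, h₂₃⟩ := Finset.two_lt_card_iff.1 hlt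
  simp only [cores, Finset.mem_filter, Finset.mem_univ, true_and] at hc₁ hc₂ hc₃
  obtain ⟨v₁, w₁, R₁⟩ := c₁
  obtain ⟨v₂, w₂, R₂⟩ := c₂
  obtain ⟨v₃, w₃, R₃⟩ := c₃
  obtain ⟨h₁, hs₁⟩ := hc₁
  obtain ⟨h₂, hs₂⟩ := hc₂
  obtain ⟨h₃, hs₃⟩ := hc₃
  have key : ∀ {v w v' w' : V} {R R' : Finset V}, (v, w, R) ≠ (v', w', R') →
      IsCore T k d l m v w R → IsCore T k d l m v' w' R' → IsConfig T p e (v, w, R) s →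
      IsConfig T p e (v', w', R') s → v ≠ v' := by
    rintro v w v' w' R R' hne h h' hs hs' rfl
    obtain ⟨rfl, rfl⟩ := h.eq_of_isConfig hT h' hs hs'
    exact hne rfl
  have n₁₂ := key h₁₂ h₁ h₂ hs₁ hs₂
  have n₁₃ := key h₁₃ h₁ h₃ hs₁ hs₃
  have n₂₃ := key h₂₃ h₂ h₃ hs₂ hs₃
  have key' : ∀ {v w v' w' : V} {R R' : Finset V}, v ≠ v' →
      IsCore T k d l m v w R → IsCore T k d l m v' w' R' → IsConfig T p e (v, w, R) s →
      IsConfig T p e (v', w', R') s → v' ∈ R ∧ T.dist w v' < T.dist v v' := by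
    rintro v w v' w' R R' hne h h' ⟨P, hP, Q, hQ, rfl⟩ ⟨P', hP', Q', hQ', heq⟩
    rw [Finset.mem_powersetCard] at hQ hQ'
    have := h.root_mem_of_isConfig hT hp h' (Finset.mem_powersetCard.1 hP).1 hQ.1 hP' hQ'.1
      (hQ.2.trans hQ'.2.symm) heq hne.symm
    exact ⟨this, h.side v' this hne.symm⟩
  have key'' : ∀ {v w : V} {R : Finset V}, IsCore T k d l m v w R → IsConfig T p e (v, w, R) s →
      RootedAt T v s ∧ 2 ≤ degIn T s v := by
    rintro v w R h ⟨P, hP, Q, hQ, rfl⟩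
    rw [Finset.mem_powersetCard] at hP hQ
    refine ⟨h.toIsStem.rootedAt_config hT hP.1 hQ.1, ?_⟩
    dsimp only
    rw [h.toIsStem.degIn_root hT hP.1 hQ.1]
    omega
  obtain ⟨m₂, -⟩ := key' n₁₂ h₁ h₂ hs₁ hs₂
  obtain ⟨m₃, -⟩ := key' n₁₃ h₁ h₃ hs₁ hs₃
  obtain ⟨-, m₂₁⟩ := key' n₁₂.symm h₂ h₁ hs₂ hs₁
  obtain ⟨-, m₂₃⟩ := key' n₂₃ h₂ h₃ hs₂ hs₃
  obtain ⟨-, m₃₁⟩ := key' n₁₃.symm h₃ h₁ hs₃ hs₁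
  obtain ⟨-, m₃₂⟩ := key' n₂₃.symm h₃ h₂ hs₃ hs₂
  obtain ⟨r₂, d₂⟩ := key'' h₂ hs₂
  obtain ⟨r₃, d₃⟩ := key'' h₃ hs₃
  obtain ⟨P, hP, Q, hQ, rfl⟩ := hs₁
  rw [Finset.mem_powersetCard] at hP hQ
  exact h₁.false_of_three hT hP.1 hQ.1 r₂ r₃ m₂ m₃ n₁₂.symm n₁₃.symm n₂₃ d₂ d₃ h₂.adj m₂₁ m₂₃
    h₃.adj m₃₁ m₃₂

end Multiplicity

section Growth
open scoped Classical
variable {V : Type*} (T : SimpleGraph V)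

/-- `s'` is obtained from `s` by adding the vertex next to `s` that is nearest to `t`, and its
neighbour in `s` has a degree satisfying `pr`. -/
def Grow (t : V) (pr : ℕ → Prop) (s s' : Finset V) : Prop :=
  ∃ q ∈ s, ∃ y ∉ s, T.Adj q y ∧ (∀ z ∈ s, T.dist t y < T.dist t z) ∧ s' = insert y s ∧
    pr (degIn T s q)

variable {T} {t v : V} {pr : ℕ → Prop} {s s₁ s₂ s' : Finset V}

lemma Grow.left_unique (h₁ : Grow T t pr s₁ s') (h₂ : Grow T t pr s₂ s') : s₁ = s₂ := by
  obtain ⟨q₁, -, y₁, hy₁, -, hd₁, hs₁, -⟩ := h₁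
  obtain ⟨q₂, -, y₂, hy₂, -, hd₂, hs₂, -⟩ := h₂
  have heq : y₁ = y₂ := by
    by_contra hne
    have m₁ : y₁ ∈ insert y₂ s₂ := by rw [← hs₂, hs₁]; exact Finset.mem_insert_self _ _
    have m₂ : y₂ ∈ insert y₁ s₁ := by rw [← hs₁, hs₂]; exact Finset.mem_insert_self _ _
    have := hd₁ y₂ ((Finset.mem_insert.1 m₂).resolve_left (Ne.symm hne))
    have := hd₂ y₁ ((Finset.mem_insert.1 m₁).resolve_left hne)
    omega
  subst heq
  rw [← Finset.erase_insert hy₁, ← Finset.erase_insert hy₂, ← hs₁, ← hs₂]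

lemma Grow.rootedAt (hT : T.IsTree) (hs : RootedAt T v s) (h : Grow T t pr s s') :
    RootedAt T v s' := by
  obtain ⟨q, hq, y, hy, hqy, -, rfl, -⟩ := h
  exact hs.insert_adj hT hy hq hqy.symm

lemma Grow.card (h : Grow T t pr s s') : s'.card = s.card + 1 := by
  obtain ⟨q, hq, y, hy, hqy, -, rfl, -⟩ := h
  exact Finset.card_insert_of_notMem hy

lemma Grow.card_leavesIn_of_leaf (hT : T.IsTree) (hs : RootedAt T v s)
    (h : Grow T t (· = 1) s s') : (leavesIn T s').card = (leavesIn T s).card := by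
  obtain ⟨q, hq, y, hy, hqy, -, rfl, hd⟩ := h
  exact hs.card_leavesIn_insert_of_leaf hT hy hq hqy.symm hd

lemma Grow.card_leavesIn_of_inner (hT : T.IsTree) (hs : RootedAt T v s)
    (h : Grow T t (2 ≤ ·) s s') : (leavesIn T s').card = (leavesIn T s).card + 1 := by
  obtain ⟨q, hq, y, hy, hqy, -, rfl, hd⟩ := h
  exact hs.card_leavesIn_insert_of_inner hT hy hq hqy.symm hd

lemma exists_closer_of_notMem (hT : T.IsTree) {q : V} (ht : t ∉ s) (hq : q ∈ s)
    (hmin : ∀ z ∈ s, T.dist t q ≤ T.dist t z) :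
    ∃ y ∉ s, T.Adj q y ∧ ∀ z ∈ s, T.dist t y < T.dist t z := by
  obtain ⟨y, hqy, hd⟩ := exists_adj_dist_lt hT.connected (v := t) (a := q)
    (by rintro rfl; exact ht hq)
  have hlt : ∀ z ∈ s, T.dist t y < T.dist t z := fun z hz => by
    have := hmin z hz
    omega
  exact ⟨y, fun hy => lt_irrefl _ (hlt y hy), hqy, hlt⟩

lemma RootedAt.notMem_of_card_le (hT : T.IsTree) (h : RootedAt T v s) (hd : s.card ≤ T.dist v t) :
    t ∉ s := fun ht => by
  have := h.dist_lt_card hT ht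
  omega

lemma exists_grow (hT : T.IsTree) {q : V} (ht : t ∉ s) (hq : q ∈ s)
    (hmin : ∀ z ∈ s, T.dist t q ≤ T.dist t z) (hpr : pr (degIn T s q)) :
    ∃ s', Grow T t pr s s' := by
  obtain ⟨y, hy, hqy, hlt⟩ := exists_closer_of_notMem hT ht hq hmin
  exact ⟨_, q, hq, y, hy, hqy, hlt, rfl, hpr⟩

lemma exists_grow_grow (hT : T.IsTree) {q : V} (h : RootedAt T v s)
    (hd : s.card + 1 ≤ T.dist v t) (hq : q ∈ s)
    (hmin : ∀ z ∈ s, T.dist t q ≤ T.dist t z) (hdeg : degIn T s q = 1) :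
    ∃ s₁ s', Grow T t (· = 1) s s₁ ∧ Grow T t (· = 1) s₁ s' := by
  obtain ⟨y, hy, hqy, hlt⟩ := exists_closer_of_notMem hT (h.notMem_of_card_le hT (by omega)) hq hmin
  have h₁ : Grow T t (· = 1) s (insert y s) := ⟨q, hq, y, hy, hqy, hlt, rfl, hdeg⟩
  obtain ⟨s', hs'⟩ := exists_grow (pr := (· = 1)) hT (s := insert y s) (q := y)
    ((h₁.rootedAt hT h).notMem_of_card_le hT (h₁.card ▸ hd)) (Finset.mem_insert_self _ _)
    (fun z hz => by
      rcases Finset.mem_insert.1 hz with rfl | hz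
      · exact le_rfl
      · exact (hlt z hz).le)
    (h.degIn_insert_self hT hy hq hqy.symm)
  exact ⟨_, s', h₁, hs'⟩

/-- If `a` lies on the side of `w` of the edge `vw` and `t` lies on the side of `v`, then the
path from `a` to `t` passes through `v`. -/
lemma dist_lt_of_sides (hT : T.IsTree) {w : V} (hvw : T.Adj v w)
    (ht : ¬ T.dist w t < T.dist v t) {a : V} (ha : T.dist w a < T.dist v a) :
    T.dist t v < T.dist t a := by
  have key : ∀ n, ∀ a, T.dist t a = n → T.dist w a < T.dist v a → T.dist t v < T.dist t a := by
    intro n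
    induction n using Nat.strong_induction_on with
    | _ n ih =>
      intro a hn ha
      obtain ⟨b, hab, hd⟩ := exists_adj_dist_lt hT.connected (v := t) (a := a)
        (by rintro rfl; exact ht ha)
      by_cases hb : T.dist w b < T.dist v b
      · have := ih _ (by omega) b rfl hb
        omega
      · have := (eq_of_adj_of_sides hT hvw hab ha hb).2
        subst this
        omega
  exact key _ a rfl ha

end Growth

section Families
open scoped Classical
variable {V : Type*} [Fintype V] (T : SimpleGraph V)

/-- The vertex sets obtained from the core `c` by attaching `p` vertices to its root and `e`
vertices to these. -/
noncomputable def configs (p e : ℕ) (c : V × V × Finset V) : Finset (Finset V) :=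
  Finset.univ.filter (IsConfig T p e c)

/-- The vertex sets obtained by attaching `d + 1` vertices to the root of the core `c`, and then
growing once towards `t` at an internal vertex. -/
noncomputable def innerGrown (d : ℕ) (t : V) (c : V × V × Finset V) : Finset (Finset V) :=
  Finset.univ.filter fun s' => ∃ s, IsConfig T (d + 1) 0 c s ∧ Grow T t (2 ≤ ·) s s'

/-- The vertex sets obtained by attaching `d` vertices to the root of the core `c`, and then
growing twice towards `t` at a leaf. -/
noncomputable def leafGrown (d : ℕ) (t : V) (c : V × V × Finset V) : Finset (Finset V) :=
  Finset.univ.filter fun s' =>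
    ∃ s s₁, IsConfig T d 0 c s ∧ Grow T t (· = 1) s s₁ ∧ Grow T t (· = 1) s₁ s'

/-- The subtrees with `k` vertices that differ from the copies of the caterpillar in the number of
leaves or of leaves with a neighbour of degree two. -/
noncomputable def nonCopies (k l m : ℕ) : Finset (Finset V) :=
  Finset.univ.filter fun s => s.card = k ∧ (T.induce (s : Set V)).Connected ∧
    ((leavesIn T s).card ≠ l ∨ (deepLeavesIn T s).card ≠ m)

variable {T} {k d l m p e : ℕ} {t v w : V} {R : Finset V} {c : V × V × Finset V}

lemma sum_card_le_of_card_filter_le {α β : Type*} (C : Finset α) (F : α → Finset β) (N : Finset β)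
    (hF : ∀ c ∈ C, F c ⊆ N) (h2 : ∀ s, (C.filter fun c => s ∈ F c).card ≤ 2) :
    ∑ c ∈ C, (F c).card ≤ 2 * N.card := by
  have h1 : ∀ c ∈ C, (F c).card = (N.filter fun s => s ∈ F c).card := by
    intro c hc
    congr 1
    ext s
    rw [Finset.mem_filter]
    exact ⟨fun h => ⟨hF c hc h, h⟩, fun h => h.2⟩
  rw [Finset.sum_congr rfl h1]
  have := Finset.sum_card_bipartiteAbove_eq_sum_card_bipartiteBelow (s := C) (t := N)
    (fun c s => s ∈ F c)
  simp only [Finset.bipartiteAbove, Finset.bipartiteBelow] at this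
  rw [this, mul_comm]
  exact (Finset.sum_le_card_nsmul _ _ 2 fun s _ => h2 s).trans (by simp)

lemma sum_card_configs_le (hT : T.IsTree) (hp : 1 ≤ p)
    (h : ∀ c ∈ cores T k d l m, configs T p e c ⊆ nonCopies T k l m) :
    ∑ c ∈ cores T k d l m, (configs T p e c).card ≤ 2 * (nonCopies T k l m).card := by
  refine sum_card_le_of_card_filter_le _ _ _ h fun s => ?_
  simp only [configs, Finset.mem_filter, Finset.mem_univ, true_and]
  exact card_filter_isConfig_le hT hp s

lemma sum_card_innerGrown_le (hT : T.IsTree)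
    (h : ∀ c ∈ cores T k d l m, innerGrown T d t c ⊆ nonCopies T k l m) :
    ∑ c ∈ cores T k d l m, (innerGrown T d t c).card ≤ 2 * (nonCopies T k l m).card := by
  refine sum_card_le_of_card_filter_le _ _ _ h fun s' => ?_
  simp only [innerGrown, Finset.mem_filter, Finset.mem_univ, true_and]
  by_cases hs : ∃ s, Grow T t (2 ≤ ·) s s'
  · obtain ⟨s, hs⟩ := hs
    refine (Finset.card_le_card fun c hc => ?_).trans
      (card_filter_isConfig_le (k := k) (d := d) (l := l) (m := m) (p := d + 1) (e := 0) hT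
        (by omega) s)
    rw [Finset.mem_filter] at hc ⊢
    obtain ⟨hc, s₂, hc₂, hs₂⟩ := hc
    rw [hs.left_unique hs₂]
    exact ⟨hc, hc₂⟩
  · rw [Finset.filter_false_of_mem]
    · simp
    · rintro c - ⟨s, -, hs'⟩
      exact hs ⟨s, hs'⟩

lemma sum_card_leafGrown_le (hT : T.IsTree) (hd : 1 ≤ d)
    (h : ∀ c ∈ cores T k d l m, leafGrown T d t c ⊆ nonCopies T k l m) :
    ∑ c ∈ cores T k d l m, (leafGrown T d t c).card ≤ 2 * (nonCopies T k l m).card := by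
  refine sum_card_le_of_card_filter_le _ _ _ h fun s' => ?_
  simp only [leafGrown, Finset.mem_filter, Finset.mem_univ, true_and]
  by_cases hs : ∃ s s₁, Grow T t (· = 1) s s₁ ∧ Grow T t (· = 1) s₁ s'
  · obtain ⟨s, s₁, hs, hs₁⟩ := hs
    refine (Finset.card_le_card fun c hc => ?_).trans
      (card_filter_isConfig_le (k := k) (d := d) (l := l) (m := m) (p := d) (e := 0) hT hd s)
    rw [Finset.mem_filter] at hc ⊢
    obtain ⟨hc, s₂, s₃, hc₂, hs₂, hs₃⟩ := hc
    rw [← hs₁.left_unique hs₃] at hs₂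
    rw [hs.left_unique hs₂]
    exact ⟨hc, hc₂⟩
  · rw [Finset.filter_false_of_mem]
    · simp
    · rintro c - ⟨s, s₁, -, hs'⟩
      exact hs ⟨s, s₁, hs'⟩

lemma isConfig_zero {s : Finset V} (h : IsConfig T p 0 c s) :
    ∃ P ⊆ sideNbrs T c.1 c.2.1, P.card = p ∧ s = c.2.2 ∪ P := by
  obtain ⟨P, hP, Q, hQ, rfl⟩ := h
  rw [Finset.mem_powersetCard] at hP hQ
  exact ⟨P, hP.1, hP.2, by rw [Finset.card_eq_zero.1 hQ.2, Finset.union_empty]⟩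

lemma IsStem.rootedAt_union (hT : T.IsTree) {P : Finset V} (h : IsStem T v w R)
    (hP : P ⊆ sideNbrs T v w) : RootedAt T v (R ∪ P) ∧ (R ∪ P).card = R.card + P.card := by
  have h1 := h.rootedAt_config hT hP (Q := ∅) (by simp)
  have h2 := h.card_config hT hP (Q := ∅) (by simp)
  rw [Finset.union_empty] at h1 h2
  exact ⟨h1, by simpa using h2⟩

lemma configs_add_two_subset (hT : T.IsTree) (hc : c ∈ cores T k d l m) :
    configs T (d + 2) 0 c ⊆ nonCopies T k l m := by
  intro s hs
  have h : IsCore T k d l m c.1 c.2.1 c.2.2 := (Finset.mem_filter.1 hc).2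
  obtain ⟨P, hP, hPc, rfl⟩ := isConfig_zero (Finset.mem_filter.1 hs).2
  obtain ⟨h1, h2⟩ := h.toIsStem.rootedAt_union hT hP
  have h3 := h.card_leavesIn_union hT hP (Finset.card_pos.1 (by omega))
  have h4 := h.card
  refine Finset.mem_filter.2 ⟨Finset.mem_univ _, by omega, h1.connected, Or.inl (by omega)⟩

lemma configs_two_subset (hT : T.IsTree) (hc : c ∈ cores T k d l m) :
    configs T d 2 c ⊆ nonCopies T k l m := by
  intro s hs
  have h : IsCore T k d l m c.1 c.2.1 c.2.2 := (Finset.mem_filter.1 hc).2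
  obtain ⟨P, hP, Q, hQ, rfl⟩ := (Finset.mem_filter.1 hs).2
  have hne := h.leaves_or_deepLeaves_ne hT hP hQ
  rw [Finset.mem_powersetCard] at hP hQ
  have h1 := h.toIsStem.rootedAt_config hT hP.1 hQ.1
  have h2 := h.toIsStem.card_config hT hP.1 hQ.1
  have h4 := h.card
  refine Finset.mem_filter.2 ⟨Finset.mem_univ _, by omega, h1.connected, hne⟩

lemma innerGrown_subset (hT : T.IsTree) (hc : c ∈ cores T k d l m) :
    innerGrown T d t c ⊆ nonCopies T k l m := by
  intro s' hs'
  have h : IsCore T k d l m c.1 c.2.1 c.2.2 := (Finset.mem_filter.1 hc).2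
  obtain ⟨s, hs, hg⟩ := (Finset.mem_filter.1 hs').2
  obtain ⟨P, hP, hPc, rfl⟩ := isConfig_zero hs
  obtain ⟨h1, h2⟩ := h.toIsStem.rootedAt_union hT hP
  have h3 := h.card_leavesIn_union hT hP (Finset.card_pos.1 (by omega))
  have h4 := h.card
  have h5 := hg.card
  have h6 := hg.card_leavesIn_of_inner hT h1
  refine Finset.mem_filter.2 ⟨Finset.mem_univ _, by omega, (hg.rootedAt hT h1).connected,
    Or.inl (by omega)⟩

lemma leafGrown_subset (hT : T.IsTree) (hd : 1 ≤ d) (hc : c ∈ cores T k d l m) :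
    leafGrown T d t c ⊆ nonCopies T k l m := by
  intro s' hs'
  have h : IsCore T k d l m c.1 c.2.1 c.2.2 := (Finset.mem_filter.1 hc).2
  obtain ⟨s, s₁, hs, hg, hg₁⟩ := (Finset.mem_filter.1 hs').2
  obtain ⟨P, hP, hPc, rfl⟩ := isConfig_zero hs
  obtain ⟨h1, h2⟩ := h.toIsStem.rootedAt_union hT hP
  have h3 := h.card_leavesIn_union hT hP (Finset.card_pos.1 (by omega))
  have h4 := h.card
  have h5 := hg.card
  have h6 := hg.card_leavesIn_of_leaf hT h1
  have h7 := hg.rootedAt hT h1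
  have h8 := hg₁.card
  have h9 := hg₁.card_leavesIn_of_leaf hT h7
  refine Finset.mem_filter.2 ⟨Finset.mem_univ _, by omega, (hg₁.rootedAt hT h7).connected,
    Or.inl (by omega)⟩

lemma IsStem.config_inj (hT : T.IsTree) (h : IsStem T v w R) {P Q P' Q' : Finset V}
    (hP : P ⊆ sideNbrs T v w) (hQ : Q ⊆ childrenOf T v P) (hP' : P' ⊆ sideNbrs T v w)
    (hQ' : Q' ⊆ childrenOf T v P') (heq : R ∪ P ∪ Q = R ∪ P' ∪ Q') : P = P' ∧ Q = Q' := by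
  have key : ∀ {P Q P' Q' : Finset V}, P ⊆ sideNbrs T v w → Q ⊆ childrenOf T v P →
      P' ⊆ sideNbrs T v w → Q' ⊆ childrenOf T v P' → R ∪ P ∪ Q = R ∪ P' ∪ Q' →
      P ⊆ P' ∧ Q ⊆ Q' := by
    intro P Q P' Q' hP hQ hP' hQ' heq
    have hd := h.disjoint hT hP hQ
    constructor
    · intro a ha
      have ha' : a ∈ R ∪ P' ∪ Q' := by rw [← heq]; simp [ha]
      rw [Finset.mem_union, Finset.mem_union] at ha'
      rcases ha' with (ha' | ha') | ha'
      · exact absurd (by simp [ha]) (Finset.disjoint_left.1 hd ha')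
      · exact ha'
      · have := dist_childrenOf hT hP' (hQ' ha')
        rw [dist_sideNbrs (hP ha)] at this
        omega
    · intro a ha
      have ha' : a ∈ R ∪ P' ∪ Q' := by rw [← heq]; simp [ha]
      rw [Finset.mem_union, Finset.mem_union] at ha'
      rcases ha' with (ha' | ha') | ha'
      · exact absurd (by simp [ha]) (Finset.disjoint_left.1 hd ha')
      · have := dist_childrenOf hT hP (hQ ha)
        rw [dist_sideNbrs (hP' ha')] at this
        omega
      · exact ha'
  obtain ⟨h₁, h₂⟩ := key hP hQ hP' hQ' heq
  obtain ⟨h₃, h₄⟩ := key hP' hQ' hP hQ heq.symm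
  exact ⟨h₁.antisymm h₃, h₂.antisymm h₄⟩

lemma IsStem.card_configs (hT : T.IsTree) (h : IsStem T v w R) :
    (configs T p e (v, w, R)).card =
      ∑ P ∈ (sideNbrs T v w).powersetCard p, (childrenOf T v P).card.choose e := by
  have : configs T p e (v, w, R) = (((sideNbrs T v w).powersetCard p).sigma
      fun P => (childrenOf T v P).powersetCard e).image fun x => R ∪ x.1 ∪ x.2 := by
    ext s
    simp only [configs, IsConfig, Finset.mem_filter, Finset.mem_univ, true_and, Finset.mem_image,
      Finset.mem_sigma, Sigma.exists]
    constructor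
    · rintro ⟨P, hP, Q, hQ, rfl⟩
      exact ⟨P, Q, ⟨hP, hQ⟩, rfl⟩
    · rintro ⟨P, Q, ⟨hP, hQ⟩, rfl⟩
      exact ⟨P, hP, Q, hQ, rfl⟩
  rw [this, Finset.card_image_of_injOn, Finset.card_sigma]
  · simp only [Finset.card_powersetCard]
  · rintro ⟨P, Q⟩ hx ⟨P', Q'⟩ hx' heq
    simp only [Finset.coe_sigma, Set.mem_sigma_iff, Finset.mem_coe, Finset.mem_powersetCard]
      at hx hx'
    obtain ⟨rfl, rfl⟩ := h.config_inj hT hx.1.1 hx.2.1 hx'.1.1 hx'.2.1 heq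
    rfl

end Families

section GrowthCount
open scoped Classical
variable {V : Type*} [Fintype V] {T : SimpleGraph V} {k d l m : ℕ} {t v w : V} {R : Finset V}

lemma isConfig_union {p : ℕ} {P : Finset V} (hP : P ⊆ sideNbrs T v w) (hPc : P.card = p) :
    IsConfig T p 0 (v, w, R) (R ∪ P) :=
  ⟨P, Finset.mem_powersetCard.2 ⟨hP, hPc⟩, ∅, by simp, by simp⟩

lemma IsStem.union_inj (hT : T.IsTree) (h : IsStem T v w R) {P P' : Finset V}
    (hP : P ⊆ sideNbrs T v w) (hP' : P' ⊆ sideNbrs T v w) (heq : R ∪ P = R ∪ P') : P = P' :=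
  (h.config_inj hT hP (Q := ∅) (by simp) hP' (Q' := ∅) (by simp) (by simpa using heq)).1

lemma IsStem.choose_le_card_innerGrown (hT : T.IsTree) (h : IsStem T v w R)
    (hex : ∀ P ⊆ sideNbrs T v w, P.card = d + 1 → ∃ s', Grow T t (2 ≤ ·) (R ∪ P) s') :
    (sideNbrs T v w).card.choose (d + 1) ≤ (innerGrown T d t (v, w, R)).card := by
  rw [← Finset.card_powersetCard]
  refine Finset.card_le_card_of_forall_subsingleton
    (fun P s' => Grow T t (2 ≤ ·) (R ∪ P) s') (fun P hP => ?_) ?_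
  · rw [Finset.mem_powersetCard] at hP
    obtain ⟨s', hs'⟩ := hex P hP.1 hP.2
    exact ⟨s', Finset.mem_filter.2 ⟨Finset.mem_univ _, _, isConfig_union hP.1 hP.2, hs'⟩, hs'⟩
  · rintro s' - P ⟨hP, hPs⟩ P' ⟨hP', hPs'⟩
    exact h.union_inj hT (Finset.mem_powersetCard.1 hP).1 (Finset.mem_powersetCard.1 hP').1
      (hPs.left_unique hPs')

lemma IsStem.card_le_card_leafGrown (hT : T.IsTree) (h : IsStem T v w R)
    {A : Finset (Finset V)} (hA : A ⊆ (sideNbrs T v w).powersetCard d)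
    (hex : ∀ P ∈ A, ∃ s₁ s', Grow T t (· = 1) (R ∪ P) s₁ ∧ Grow T t (· = 1) s₁ s') :
    A.card ≤ (leafGrown T d t (v, w, R)).card := by
  refine Finset.card_le_card_of_forall_subsingleton
    (fun P s' => ∃ s₁, Grow T t (· = 1) (R ∪ P) s₁ ∧ Grow T t (· = 1) s₁ s') (fun P hP => ?_) ?_
  · obtain ⟨s₁, s', hs₁, hs'⟩ := hex P hP
    obtain ⟨hP, hPc⟩ := Finset.mem_powersetCard.1 (hA hP)
    exact ⟨s', Finset.mem_filter.2 ⟨Finset.mem_univ _, _, s₁, isConfig_union hP hPc, hs₁, hs'⟩,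
      s₁, hs₁, hs'⟩
  · rintro s' - P ⟨hP, s₁, hPs, hPs₁⟩ P' ⟨hP', s₁', hPs', hPs₁'⟩
    rw [← hPs₁.left_unique hPs₁'] at hPs'
    exact h.union_inj hT (Finset.mem_powersetCard.1 (hA hP)).1
      (Finset.mem_powersetCard.1 (hA hP')).1 (hPs.left_unique hPs')

lemma IsStem.one_le_degIn {V : Type*} {T : SimpleGraph V} {v w : V} {R : Finset V}
    (h : IsStem T v w R) {q : V} (hq : q ∈ R) (hqv : q ≠ v) :
    1 ≤ degIn T R q := by
  obtain ⟨b, hb, hqb, -⟩ := h.root.2 q hq hqv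
  exact Finset.card_pos.2 ⟨b, Finset.mem_filter.2 ⟨hb, hqb⟩⟩

lemma IsCore.choose_le_card_grown (hT : T.IsTree) (h : IsCore T k d l m v w R) (hd : 1 ≤ d)
    (ht : k ≤ T.dist v t) :
    ((sideNbrs T v w).card - 1).choose d ≤
        (innerGrown T d t (v, w, R)).card + (leafGrown T d t (v, w, R)).card ∨
      ((sideNbrs T v w).card - 1).choose (d - 1) ≤
        (innerGrown T d t (v, w, R)).card + (leafGrown T d t (v, w, R)).card := by
  have hstem := h.toIsStem
  have hcard := h.card
  have hroot : ∀ P ⊆ sideNbrs T v w, P.card ≤ d + 1 →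
      RootedAt T v (R ∪ P) ∧ (R ∪ P).card = R.card + P.card :=
    fun P hP _ => hstem.rootedAt_union hT hP
  by_cases hside : T.dist w t < T.dist v t
  · left
    obtain ⟨q, hq, hmin⟩ := Finset.exists_min_image (R.erase v) (T.dist t)
      ⟨w, Finset.mem_erase.2 ⟨h.adj.ne', h.mem⟩⟩
    obtain ⟨hqv, hqR⟩ := Finset.mem_erase.1 hq
    have hqw := hmin w (Finset.mem_erase.2 ⟨h.adj.ne', h.mem⟩)
    have hqmin : ∀ P ⊆ sideNbrs T v w, ∀ z ∈ R ∪ P, T.dist t q ≤ T.dist t z := by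
      intro P hP z hz
      by_cases hzv : z = v
      · subst hzv
        rw [SimpleGraph.dist_comm, SimpleGraph.dist_comm (u := z)] at hside
        omega
      rcases Finset.mem_union.1 hz with hz | hz
      · exact hmin z (Finset.mem_erase.2 ⟨hzv, hz⟩)
      · obtain ⟨hvz, hzw⟩ := mem_sideNbrs.1 (hP hz)
        rw [SimpleGraph.dist_comm, SimpleGraph.dist_comm (u := v)] at hside
        rcases hT.dist_eq_dist_add_one_of_adj t hvz with e | e
        · exact absurd (eq_of_adj_of_dist_lt hT hvz h.adj (v := t) (by omega) hside) hzw
        · omega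
    have hdeg : ∀ P ⊆ sideNbrs T v w, degIn T (R ∪ P) q = degIn T R q := by
      intro P hP
      have := hstem.degIn_core hT hP (Q := ∅) (by simp) hqR hqv
      rwa [Finset.union_empty] at this
    have h1 := hstem.one_le_degIn hqR hqv
    by_cases h2 : 2 ≤ degIn T R q
    · have := hstem.choose_le_card_innerGrown (d := d) (t := t) hT fun P hP hPc => by
        obtain ⟨hr, hc⟩ := hroot P hP (by omega)
        exact exists_grow hT (hr.notMem_of_card_le hT (by omega)) (Finset.mem_union_left _ hqR)
          (hqmin P hP) (by rwa [hdeg P hP])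
      cases hN : (sideNbrs T v w).card with
      | zero => rw [Nat.choose_eq_zero_of_lt (by omega)]; exact Nat.zero_le _
      | succ n =>
        rw [hN, Nat.choose_succ_succ] at this
        rw [Nat.add_sub_cancel]
        omega
    · have := hstem.card_le_card_leafGrown (d := d) (t := t) hT subset_rfl fun P hP => by
        obtain ⟨hP, hPc⟩ := Finset.mem_powersetCard.1 hP
        obtain ⟨hr, hc⟩ := hroot P hP (by omega)
        exact exists_grow_grow hT hr (by omega) (Finset.mem_union_left _ hqR)
          (hqmin P hP) (by rw [hdeg P hP]; omega)
      rw [Finset.card_powersetCard] at this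
      have h3 := Nat.choose_le_choose d (Nat.sub_le (sideNbrs T v w).card 1)
      omega
  · right
    obtain ⟨i, hvi, hdi⟩ := exists_adj_dist_lt hT.connected (v := t) (a := v) (by
      rintro rfl
      rw [SimpleGraph.dist_self] at ht
      have := Finset.card_pos.2 ⟨w, h.mem⟩
      omega)
    have hiw : i ≠ w := by
      rintro rfl
      rw [SimpleGraph.dist_comm, SimpleGraph.dist_comm (u := v)] at hside
      omega
    have hi : i ∈ sideNbrs T v w := mem_sideNbrs.2 ⟨hvi, hiw⟩
    have himin : ∀ P ⊆ sideNbrs T v w, ∀ z ∈ R ∪ P, T.dist t i ≤ T.dist t z := by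
      intro P hP z hz
      by_cases hzv : z = v
      · subst hzv; omega
      rcases Finset.mem_union.1 hz with hz | hz
      · have := dist_lt_of_sides hT h.adj hside (hstem.side z hz hzv)
        omega
      · obtain ⟨hvz, hzw⟩ := mem_sideNbrs.1 (hP hz)
        rcases hT.dist_eq_dist_add_one_of_adj t hvz with e | e <;> omega
    have hdeg : ∀ P ⊆ sideNbrs T v w, i ∈ P → degIn T (R ∪ P) i = 1 := by
      intro P hP hiP
      have := hstem.degIn_left hT hP (Q := ∅) (by simp) hiP
      rwa [Finset.union_empty] at this
    have := hstem.card_le_card_leafGrown (d := d) (t := t) hT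
      (A := ((sideNbrs T v w).powersetCard d).filter fun P => {i} ⊆ P) (Finset.filter_subset _ _)
      fun P hP => by
        rw [Finset.mem_filter, Finset.mem_powersetCard, Finset.singleton_subset_iff] at hP
        obtain ⟨⟨hP, hPc⟩, hiP⟩ := hP
        obtain ⟨hr, hc⟩ := hroot P hP (by omega)
        exact exists_grow_grow hT hr (by omega) (Finset.mem_union_right _ hiP)
          (himin P hP) (hdeg P hP hiP)
    rw [Finset.card_filter_powersetCard_subset _ _ _ (by simpa using hi) (by simpa using hd),
      Finset.card_singleton] at this
    omega

end GrowthCount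

section Arithmetic

lemma sum_powersetCard_sum {ι : Type*} [DecidableEq ι] (I : Finset ι) (f : ι → ℕ) {j : ℕ}
    (hj : 1 ≤ j) : ∑ P ∈ I.powersetCard j, ∑ i ∈ P, f i =
      (∑ i ∈ I, f i) * (I.card - 1).choose (j - 1) := by
  have h1 : ∀ P ∈ I.powersetCard j, ∑ i ∈ P, f i = ∑ i ∈ I, if {i} ⊆ P then f i else 0 := by
    intro P hP
    rw [← Finset.sum_filter]
    refine Finset.sum_congr ?_ fun _ _ => rfl
    ext i
    rw [Finset.mem_filter, Finset.singleton_subset_iff]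
    exact ⟨fun h => ⟨(Finset.mem_powersetCard.1 hP).1 h, h⟩, fun h => h.2⟩
  rw [Finset.sum_congr rfl h1, Finset.sum_comm, Finset.sum_mul]
  refine Finset.sum_congr rfl fun i hi => ?_
  rw [← Finset.sum_filter, Finset.sum_const,
    Finset.card_filter_powersetCard_subset _ _ _ (by simpa using hi) (by simpa using hj),
    Finset.card_singleton, smul_eq_mul, mul_comm]

lemma two_mul_cast_choose_two_ge (m : ℕ) (x : ℝ) :
    (2 * x - 1) * m - x ^ 2 ≤ 2 * (m.choose 2 : ℝ) := by
  rw [Nat.cast_choose_two]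
  nlinarith [sq_nonneg ((m : ℝ) - x)]

/-- Tangent line bound for the sum of the numbers of pairs. -/
lemma le_two_mul_sum_choose_two {ι : Type*} (A : Finset ι) (g : ι → ℕ) (x : ℝ) :
    (2 * x - 1) * (∑ P ∈ A, g P : ℕ) - x ^ 2 * A.card ≤ 2 * ((∑ P ∈ A, (g P).choose 2 : ℕ) : ℝ) := by
  have := Finset.sum_le_sum fun P (_ : P ∈ A) => two_mul_cast_choose_two_ge (g P) x
  rw [Finset.sum_sub_distrib, ← Finset.mul_sum, ← Finset.mul_sum, Finset.sum_const,
    nsmul_eq_mul] at this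
  push_cast
  linarith

lemma mul_le_of_two_mul_le {n d M K B Y : ℝ} (hn : n = 0 ∨ 1 ≤ n) (hd : 1 ≤ d)
    (hK : 0 ≤ K) (hM : 0 ≤ M) (hB : B * ((d + 1) * (d + 2)) = (n + d + 1) * n * K)
    (hM2 : 2 * (n + d + 1) ≤ d * M)
    (hY : K * (d * M) ^ 2 ≤ 4 * (n + d + 1) * (n + 1) * Y) : M * K ≤ 12 * (B + Y) := by
  have hn0 : 0 ≤ n := by rcases hn with rfl | h <;> linarith
  have hN : 0 < n + d + 1 := by linarith
  have hB0 : 0 ≤ B := by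
    have h1 : 0 ≤ (n + d + 1) * n * K := by positivity
    rw [← hB] at h1
    exact nonneg_of_mul_nonneg_left h1 (by positivity)
  have hY0 : 0 ≤ Y := by
    have h1 : 0 ≤ K * (d * M) ^ 2 := by positivity
    exact nonneg_of_mul_nonneg_right (h1.trans hY) (by positivity)
  rcases hn with rfl | hn
  · have h1 : K * (d * M) * (2 * (0 + d + 1)) ≤ K * (d * M) * (d * M) :=
      mul_le_mul_of_nonneg_left hM2 (by positivity)
    have h2 : K * (d * M) ≤ 2 * Y := by
      refine le_of_mul_le_mul_left ?_ hN
      nlinarith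
    have h3 : M * K ≤ K * (d * M) := by nlinarith [mul_nonneg hM hK]
    linarith
  · have h1 : (n + d + 1) * n * K ≤ 6 * d ^ 2 * B := by nlinarith [mul_nonneg hB0 (sub_nonneg.2 hd)]
    have h2 : K * (d * M) ^ 2 ≤ 8 * (n + d + 1) * n * Y := by
      have : 4 * (n + d + 1) * (n + 1) * Y ≤ 8 * (n + d + 1) * n * Y := by
        nlinarith [mul_nonneg hN.le hY0]
      linarith
    have h3 : (K * M) ^ 2 ≤ 48 * (B * Y) := by
      have h4 : ((n + d + 1) * n * K) * (K * (d * M) ^ 2) ≤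
          (6 * d ^ 2 * B) * (8 * (n + d + 1) * n * Y) :=
        mul_le_mul h1 h2 (by positivity) (by positivity)
      have h5 : 0 < (n + d + 1) * n * d ^ 2 := by positivity
      refine le_of_mul_le_mul_left ?_ h5
      calc _ = ((n + d + 1) * n * K) * (K * (d * M) ^ 2) := by ring
        _ ≤ _ := h4
        _ = _ := by ring
    refine abs_le_of_sq_le_sq' ?_ (by positivity) |>.2
    nlinarith [sq_nonneg (B - Y), mul_nonneg hB0 hY0]

lemma sum_le_twelve_mul {ι : Type*} [DecidableEq ι] (I : Finset ι) (f : ι → ℕ) {d G : ℕ}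
    (hd : 1 ≤ d)
    (hG : (I.card - 1).choose d ≤ G ∨ (I.card - 1).choose (d - 1) ≤ G) :
    ∑ P ∈ I.powersetCard (d + 1), ∑ i ∈ P, f i ≤
      12 * (I.card.choose (d + 2) + ∑ P ∈ I.powersetCard d, (∑ i ∈ P, f i).choose 2 + G) := by
  rw [sum_powersetCard_sum I f (by omega), Nat.add_sub_cancel]
  have hsum := sum_powersetCard_sum I f hd
  have htan := le_two_mul_sum_choose_two (I.powersetCard d) fun P => ∑ i ∈ P, f i
  rw [hsum, Finset.card_powersetCard] at htan
  set Y := ∑ P ∈ I.powersetCard d, (∑ i ∈ P, f i).choose 2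
  set M := ∑ i ∈ I, f i
  by_cases hN : I.card ≤ d
  · rw [Nat.choose_eq_zero_of_lt (by omega)]
    simp
  obtain ⟨n, hn⟩ : ∃ n, I.card = n + d + 1 := ⟨I.card - d - 1, by omega⟩
  obtain ⟨e, rfl⟩ : ∃ e, d = e + 1 := ⟨d - 1, by omega⟩
  rw [hn] at htan hG ⊢
  simp only [Nat.add_sub_cancel] at htan hG ⊢
  have eL : (n + (e + 1)).choose (e + 1) * (e + 1) = (n + (e + 1)).choose e * (n + 1) := by
    have := Nat.choose_succ_right_eq (n + (e + 1)) e
    rwa [show n + (e + 1) - e = n + 1 by omega] at this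
  have eE : (n + (e + 1) + 1).choose (e + 1) * (n + 1) =
      (n + (e + 1) + 1) * (n + (e + 1)).choose (e + 1) := by
    have h1 := Nat.choose_succ_right_eq (n + (e + 1) + 1) (e + 1)
    have h2 := Nat.add_one_mul_choose_eq (n + (e + 1)) (e + 1)
    rw [show n + (e + 1) + 1 - (e + 1) = n + 1 by omega] at h1
    rw [h2, ← h1]
  have eB : (n + (e + 1) + 1).choose (e + 1 + 2) * ((e + 1 + 1) * (e + 1 + 2)) =
      (n + (e + 1) + 1) * n * (n + (e + 1)).choose (e + 1) := by
    have h1 := Nat.choose_succ_right_eq (n + (e + 1) + 1) (e + 1 + 1)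
    have h2 := Nat.add_one_mul_choose_eq (n + (e + 1)) (e + 1)
    rw [show n + (e + 1) + 1 - (e + 1 + 1) = n by omega] at h1
    calc _ = (n + (e + 1) + 1).choose (e + 1 + 1 + 1) * (e + 1 + 1 + 1) * (e + 1 + 1) := by ring
      _ = (n + (e + 1) + 1).choose (e + 1 + 1) * (e + 1 + 1) * n := by rw [h1]; ring
      _ = _ := by rw [← h2]; ring
  set K := (n + (e + 1)).choose (e + 1)
  set L := (n + (e + 1)).choose e
  set E := (n + (e + 1) + 1).choose (e + 1)
  set B := (n + (e + 1) + 1).choose (e + 1 + 2)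
  by_cases hM : (e + 1) * M < 2 * (n + (e + 1) + 1)
  · by_cases hnd : n < e + 1
    · have hKG : K ≤ G := by
        rcases hG with hG | hG
        · exact hG
        · refine le_trans ?_ hG
          refine Nat.le_of_mul_le_mul_right ?_ (Nat.succ_pos e)
          calc K * (e + 1) = L * (n + 1) := eL
            _ ≤ L * (e + 1) := Nat.mul_le_mul_left _ (by omega)
      have hM4 : M < 4 := by
        by_contra! h4
        nlinarith
      nlinarith
    · have h1 : M * K ≤ 12 * B := by
        have h6 : (e + 1 + 1) * (e + 1 + 2) ≤ 6 * (e + 1) ^ 2 := by nlinarith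
        refine Nat.le_of_mul_le_mul_left ?_
          (show 0 < (e + 1) * ((e + 1 + 1) * (e + 1 + 2)) by positivity)
        calc (e + 1) * ((e + 1 + 1) * (e + 1 + 2)) * (M * K)
            = ((e + 1) * M) * K * ((e + 1 + 1) * (e + 1 + 2)) := by ring
          _ ≤ (2 * (n + (e + 1) + 1)) * K * (6 * (e + 1) ^ 2) := by gcongr
          _ = 12 * (e + 1) * ((n + (e + 1) + 1) * (e + 1) * K) := by ring
          _ ≤ 12 * (e + 1) * ((n + (e + 1) + 1) * n * K) := by gcongr; omega
          _ = _ := by rw [← eB]; ring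
      omega
  · have key : (M : ℝ) * K ≤ 12 * (B + Y) := by
      have htan := htan (((e + 1 : ℕ) * M : ℝ) / (n + (e + 1 : ℕ) + 1))
      have eL' : (K : ℝ) * (e + 1 : ℕ) = L * (n + 1) := by exact_mod_cast eL
      have eE' : (E : ℝ) * (n + 1) = (n + (e + 1 : ℕ) + 1) * K := by exact_mod_cast eE
      have eB' : (B : ℝ) * (((e + 1 : ℕ) + 1) * ((e + 1 : ℕ) + 2)) =
          (n + (e + 1 : ℕ) + 1) * n * K := by exact_mod_cast eB
      have hM' : 2 * ((n : ℝ) + (e + 1 : ℕ) + 1) ≤ (e + 1 : ℕ) * M := by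
        exact_mod_cast not_lt.1 hM
      have hd' : (1 : ℝ) ≤ (e + 1 : ℕ) := by exact_mod_cast hd
      have hn0 : (n : ℝ) = 0 ∨ (1 : ℝ) ≤ n := by
        rcases Nat.eq_zero_or_pos n with h | h
        · left; exact_mod_cast h
        · right; exact_mod_cast h
      refine mul_le_of_two_mul_le hn0 hd' (Nat.cast_nonneg _) (Nat.cast_nonneg _) eB' hM' ?_
      generalize ((e + 1 : ℕ) : ℝ) = δ at *
      have hnn : (0 : ℝ) ≤ n := Nat.cast_nonneg _
      have hN : 0 < (n : ℝ) + δ + 1 := by linarith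
      set x := δ * (M : ℝ) / (n + δ + 1) with hx
      have hxM : x * (n + δ + 1) = δ * M := div_mul_cancel₀ _ hN.ne'
      have hx2 : 2 ≤ x := by rwa [hx, le_div_iff₀ hN]
      push_cast at htan
      have hML : (M : ℝ) * L * (n + 1) = x * ((n + δ + 1) * K) := by
        calc (M : ℝ) * L * (n + 1) = M * (L * (n + 1)) := by ring
          _ = (δ * M) * K := by rw [← eL']; ring
          _ = _ := by rw [← hxM]; ring
      have h1 : (x ^ 2 - x) * ((n + δ + 1) * K) ≤ 2 * (n + 1) * Y := by
        calc (x ^ 2 - x) * ((n + δ + 1) * K)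
            = (2 * x - 1) * (M * L * (n + 1)) - x ^ 2 * (E * (n + 1)) := by rw [hML, eE']; ring
          _ = ((2 * x - 1) * (M * L) - x ^ 2 * E) * (n + 1) := by ring
          _ ≤ (2 * Y) * (n + 1) := by gcongr
          _ = _ := by ring
      have hNK : 0 ≤ (n + δ + 1) * (K : ℝ) := by positivity
      have h2 : x ^ 2 * ((n + δ + 1) * K) ≤ 4 * (n + 1) * Y := by
        nlinarith [mul_nonneg (mul_nonneg (sub_nonneg.2 hx2) (by linarith : 0 ≤ x)) hNK]
      rw [← hxM]
      calc (K : ℝ) * (x * (n + δ + 1)) ^ 2 = (n + δ + 1) * (x ^ 2 * ((n + δ + 1) * K)) := by ring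
        _ ≤ (n + δ + 1) * (4 * (n + 1) * Y) := by gcongr
        _ = _ := by ring
    have : M * K ≤ 12 * (B + Y) := by exact_mod_cast key
    omega

end Arithmetic

section Counting
open scoped Classical
variable {V : Type*} [Fintype V] {T : SimpleGraph V} {k d l m : ℕ} {v w : V} {R : Finset V}

lemma card_childrenOf (hT : T.IsTree) {P : Finset V} (hP : P ⊆ sideNbrs T v w) :
    (childrenOf T v P).card = ∑ p ∈ P, (sideNbrs T p v).card := by
  refine Finset.card_biUnion fun p hp p' hp' hne => Finset.disjoint_left.2 fun q hq hq' => hne ?_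
  have hqm : q ∈ childrenOf T v P := Finset.mem_biUnion.2 ⟨p, hp, hq⟩
  have h1 := dist_childrenOf hT hP hqm
  have h2 := dist_sideNbrs (hP hp)
  have h3 := dist_sideNbrs (hP hp')
  exact eq_of_adj_of_dist_lt hT (v := v) (mem_sideNbrs.1 hq).1.symm (mem_sideNbrs.1 hq').1.symm
    (by omega) (by omega)

lemma IsCore.card_configs_le (hT : T.IsTree) (h : IsCore T k d l m v w R) (hd : 1 ≤ d) {a b : V}
    (hab : k ≤ T.dist v a ∨ k ≤ T.dist v b) :
    (configs T (d + 1) 1 (v, w, R)).card ≤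
      12 * ((configs T (d + 2) 0 (v, w, R)).card + (configs T d 2 (v, w, R)).card +
        ((innerGrown T d a (v, w, R)).card + (leafGrown T d a (v, w, R)).card) +
        ((innerGrown T d b (v, w, R)).card + (leafGrown T d b (v, w, R)).card)) := by
  set Ga := (innerGrown T d a (v, w, R)).card + (leafGrown T d a (v, w, R)).card
  set Gb := (innerGrown T d b (v, w, R)).card + (leafGrown T d b (v, w, R)).card
  have hG : ((sideNbrs T v w).card - 1).choose d ≤ Ga + Gb ∨
      ((sideNbrs T v w).card - 1).choose (d - 1) ≤ Ga + Gb := by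
    rcases hab with ht | ht <;> rcases h.choose_le_card_grown hT hd ht with h' | h' <;> omega
  have key := sum_le_twelve_mul (sideNbrs T v w) (fun p => (sideNbrs T p v).card) hd hG
  have hsum : ∀ p e, (configs T p e (v, w, R)).card =
      ∑ P ∈ (sideNbrs T v w).powersetCard p, (∑ i ∈ P, (sideNbrs T i v).card).choose e := by
    intro p e
    rw [h.toIsStem.card_configs hT]
    exact Finset.sum_congr rfl fun P hP => by
      rw [card_childrenOf hT (Finset.mem_powersetCard.1 hP).1]
  rw [hsum, hsum, hsum]
  simp only [Nat.choose_one_right, Nat.choose_zero_right, Finset.sum_const,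
    Finset.card_powersetCard, smul_eq_mul, mul_one]
  rw [add_assoc _ Ga Gb]
  exact key

lemma sum_card_configs_le_mul_nonCopies (hT : T.IsTree) (hd : 1 ≤ d) {a b : V}
    (hab : ∀ v, k ≤ T.dist v a ∨ k ≤ T.dist v b) :
    ∑ c ∈ cores T k d l m, (configs T (d + 1) 1 c).card ≤ 144 * (nonCopies T k l m).card := by
  have h := Finset.sum_le_sum fun c (hc : c ∈ cores T k d l m) =>
    IsCore.card_configs_le hT (Finset.mem_filter.1 hc).2 hd (hab c.1)
  rw [← Finset.mul_sum] at h
  simp only [Finset.sum_add_distrib, Prod.mk.eta] at h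
  have h₁ := sum_card_configs_le hT (by omega) fun c hc =>
    configs_add_two_subset (k := k) (d := d) (l := l) (m := m) hT hc
  have h₂ := sum_card_configs_le hT hd fun c hc =>
    configs_two_subset (k := k) (l := l) (m := m) hT hc
  have hi := fun t => sum_card_innerGrown_le hT fun c hc =>
    innerGrown_subset (k := k) (d := d) (l := l) (m := m) (t := t) hT hc
  have hl := fun t => sum_card_leafGrown_le hT hd fun c hc =>
    leafGrown_subset (k := k) (l := l) (m := m) (t := t) hT hd hc
  have := hi a
  have := hi b
  have := hl a
  have := hl b
  omega

variable {W : Type*} [Fintype W] {S : SimpleGraph W}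

lemma embCount_le_sum_card_configs (hT : T.IsTree) (hS : S.Connected) (hd : 1 ≤ d)
    {v u x w z : W} (h : IsForkRoot S Finset.univ d v u x w z) :
    embCount T S k ≤ ∑ c ∈ cores T k d (leavesIn S Finset.univ).card
      (deepLeavesIn S Finset.univ).card, (configs T (d + 1) 1 c).card := by
  refine le_trans ?_ Finset.card_biUnion_le
  rw [embCount, ← Set.ncard_coe_finset]
  refine Set.ncard_le_ncard ?_ (Finset.finite_toSet _)
  rintro s ⟨hs, hiso⟩
  obtain ⟨f, hinj, him, hadj, hdeg⟩ := exists_map_of_iso hiso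
  obtain ⟨hl, hm⟩ := card_leavesIn_of_iso hiso
  have hconn : (T.induce (s : Set V)).Connected := hiso.some.connected_iff.2 hS
  obtain ⟨R, P, hR, hP, hx, hsR⟩ := (h.map hinj him hadj hdeg).exists_isCore hT hd hconn
  rw [hs, hl, hm] at hR
  rw [Finset.mem_coe, Finset.mem_biUnion]
  exact ⟨(f v, f w, R), Finset.mem_filter.2 ⟨Finset.mem_univ _, hR⟩,
    Finset.mem_filter.2 ⟨Finset.mem_univ _, P, hP, {f x},
      Finset.mem_powersetCard.2 ⟨Finset.singleton_subset_iff.2 hx, Finset.card_singleton _⟩, hsR⟩⟩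

lemma embCount_add_card_nonCopies_le (hS : S.Connected) :
    embCount T S k + (nonCopies T k (leavesIn S Finset.univ).card
      (deepLeavesIn S Finset.univ).card).card ≤ subtreeCount T k := by
  rw [embCount, subtreeCount, ← Set.ncard_coe_finset, ← Set.ncard_union_eq _ (Set.toFinite _)
    (Set.toFinite _)]
  · refine Set.ncard_le_ncard (Set.union_subset ?_ ?_) (Set.toFinite _)
    · rintro s ⟨hs, hiso⟩
      exact ⟨hs, hiso.some.connected_iff.2 hS⟩
    · intro s hs
      obtain ⟨-, hs, hconn, -⟩ := Finset.mem_filter.1 (Finset.mem_coe.1 hs)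
      exact ⟨hs, hconn⟩
  · refine Set.disjoint_left.2 ?_
    rintro s ⟨-, hiso⟩ hs
    obtain ⟨-, -, -, hne⟩ := Finset.mem_filter.1 (Finset.mem_coe.1 hs)
    obtain ⟨hl, hm⟩ := card_leavesIn_of_iso hiso
    exact hne.elim (· hl) (· hm)

end Counting

/-- Let S be a caterpillar with k ≥ 10 vertices that is not a path, has
at least four internal vertices, and has a vertex vS that is the root of a fork of order 1
and is adjacent to a leaf.  If T is a tree with radius at least 4k, then
d(S,T) ≤ 1 - 10^(-3). -/
theorem density_le_of_caterpillar_small_fork {V W : Type*} [Fintype V] [Fintype W]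
    (k : ℕ) (hk : 10 ≤ k)
    (S : SimpleGraph W) (hcard : Fintype.card W = k)
    (hcat : IsCaterpillar S) (hpath : ¬ IsPathlike S)
    (hint : 4 ≤ {v | ndeg S v ≠ 1}.ncard)
    (vS : W) (hfork : ∃ u, IsFork S vS u ∧ forkOrder S vS u = 1)
    (hleaf : ∃ u, S.Adj vS u ∧ ndeg S u = 1)
    (T : SimpleGraph V) (hT : T.IsTree)
    (hrad : ∀ x : V, ∃ w : V, 4 * k ≤ T.dist x w) :
    density S T ≤ 1 - (1 / 10 : ℝ) ^ 3 := by
  obtain ⟨d, u, x, w, z, hd, h⟩ := hcat.exists_isForkRoot hint hfork hleaf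
  obtain ⟨a⟩ := hT.connected.nonempty
  obtain ⟨b, hb⟩ := hrad a
  have hab : ∀ v, k ≤ T.dist v a ∨ k ≤ T.dist v b := fun v => by
    have := hT.connected.dist_triangle (u := a) (v := v) (w := b)
    rw [SimpleGraph.dist_comm (u := a) (v := v)] at this
    omega
  have hS := hcat.1.connected
  have h₁ := (embCount_le_sum_card_configs (k := k) hT hS hd h).trans
    (sum_card_configs_le_mul_nonCopies hT hd hab)
  have h₂ := embCount_add_card_nonCopies_le (T := T) (k := k) hS
  have h₃ : 145 * embCount T S k ≤ 144 * subtreeCount T k := by omega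
  have h₄ : (145 : ℝ) * embCount T S k ≤ 144 * subtreeCount T k := by exact_mod_cast h₃
  rw [density, hcard]
  refine div_le_of_le_mul₀ (by positivity) (by norm_num) ?_
  have h₅ : (0 : ℝ) ≤ subtreeCount T k := by positivity
  norm_num
  linarith
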